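/- Let n ≥ 4 and let S = {x, y, z, w} be a set of four distinct vertices of the godan graph EA_n such that: (1) x, y, z are even permutations and w is an odd permutation; (2) w∘(12) ∉ {x, y, z}; and (3) w∘(12) is adjacent in EA_n to at most one of x, y, z. Then there exist n − 1 pairwise internally edge disjoint S-trees in EA_n. -/

import Mathlib

namespace Godan

/-- The transposition (12), using 0-based indices 0,1 for symbols 1,2. -/
def perm12 (n : ℕ) (hn : 3 ≤ n) : Equiv.Perm (Fin n) :=
  Equiv.swap ⟨0, by omega⟩ ⟨1, by omega⟩

/-- The 3-cycle (123): symbol 1 ↦ 2 ↦ 3 ↦ 1, i.e. index 0 ↦ 1 ↦ 2 ↦ 0. -/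
def perm123 (n : ℕ) (hn : 3 ≤ n) : Equiv.Perm (Fin n) :=
  Equiv.swap ⟨0, by omega⟩ ⟨2, by omega⟩ * Equiv.swap ⟨0, by omega⟩ ⟨1, by omega⟩

/-- The 3-cycle (132): symbol 1 ↦ 3 ↦ 2 ↦ 1, i.e. index 0 ↦ 2 ↦ 1 ↦ 0. -/
def perm132 (n : ℕ) (hn : 3 ≤ n) : Equiv.Perm (Fin n) :=
  Equiv.swap ⟨0, by omega⟩ ⟨1, by omega⟩ * Equiv.swap ⟨0, by omega⟩ ⟨2, by omega⟩

/-- Ω* = {(12), (123), (132)} ∪ {(12)(3i) : 4 ≤ i ≤ n}; symbol i has index i - 1,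
so the transposition (3i) is `Equiv.swap ⟨2,_⟩ k` with 3 ≤ k = i - 1 ≤ n - 1. -/
def OmegaStar (n : ℕ) (hn : 3 ≤ n) : Set (Equiv.Perm (Fin n)) :=
  {perm12 n hn, perm123 n hn, perm132 n hn} ∪
    {s | ∃ k : Fin n, 3 ≤ (k : ℕ) ∧ s = perm12 n hn * Equiv.swap ⟨2, by omega⟩ k}

/-- The godan graph EA_n: vertices are the permutations of {1,…,n}, and u,v are
adjacent iff u = v ∘ s for some s ∈ Ω* (note `(v * s) i = v (s i)` in Mathlib).
Since Ω* is closed under inverses, `fromRel` yields exactly this adjacency. -/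
def godanGraph (n : ℕ) (hn : 3 ≤ n) : SimpleGraph (Equiv.Perm (Fin n)) :=
  SimpleGraph.fromRel (fun u v => ∃ s ∈ OmegaStar n hn, u = v * s)

/-- `T 0, …, T (r-1)` is a family of r pairwise internally edge disjoint S-trees:
each `T i` is a subgraph of `G` which is a tree containing all vertices of `S`,
and for i ≠ j, `V(T i) ∩ V(T j) = S` and `E(T i) ∩ E(T j) = ∅`. -/
def IsIDSTFamily {V : Type*} (G : SimpleGraph V) (S : Set V) {r : ℕ}
    (T : Fin r → G.Subgraph) : Prop :=
  (∀ i, S ⊆ (T i).verts ∧ ((T i).coe).IsTree) ∧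
    ∀ i j, i ≠ j → (T i).verts ∩ (T j).verts = S ∧ (T i).edgeSet ∩ (T j).edgeSet = ∅

/-- The maximum number of pairwise internally edge disjoint S-trees in G. -/
noncomputable def maxIDST {V : Type*} (G : SimpleGraph V) (S : Set V) : ℕ :=
  sSup {r : ℕ | ∃ T : Fin r → G.Subgraph, IsIDSTFamily G S T}

/-- The generalized k-connectivity κ_k(G): the minimum over all k-element vertex
sets S of the maximum number of pairwise internally edge disjoint S-trees. -/
noncomputable def genConn {V : Type*} [Fintype V] (G : SimpleGraph V) (k : ℕ) : ℕ :=
  sInf {m : ℕ | ∃ S : Finset V, S.card = k ∧ maxIDST G (↑S : Set V) = m}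

section Moves

variable {n : ℕ}

/-- The position (0-based) of the symbol that is exchanged by the generators. -/
def pivot (hn : 3 ≤ n) : Fin n := ⟨2, by omega⟩

/-- The generator that brings position `k` to the pivot; `step hn (pivot hn) = (12)`. -/
def step (hn : 3 ≤ n) (k : Fin n) : Equiv.Perm (Fin n) :=
  if (k : ℕ) = 0 then perm123 n hn else if (k : ℕ) = 1 then perm132 n hn
  else perm12 n hn * Equiv.swap (pivot hn) k

lemma step_mem_OmegaStar (hn : 3 ≤ n) (k : Fin n) : step hn k ∈ OmegaStar n hn := by
  unfold step OmegaStar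
  split_ifs with h0 h1
  · simp
  · simp
  · by_cases h2 : (k : ℕ) = 2
    · have : k = pivot hn := Fin.ext h2
      exact Or.inl (Or.inl (by simp only [this, Equiv.swap_self]; exact mul_one _))
    · exact Or.inr ⟨k, by omega, rfl⟩

lemma step_pivot (hn : 3 ≤ n) (k : Fin n) : step hn k (pivot hn) = k := by
  unfold step perm123 perm132 perm12 pivot
  split_ifs with h0 h1
  · simp only [Equiv.Perm.mul_apply, Equiv.swap_apply_def, Fin.ext_iff]
    split_ifs <;> simp_all
  · simp only [Equiv.Perm.mul_apply, Equiv.swap_apply_def, Fin.ext_iff]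
    split_ifs <;> simp_all
  · simp only [Equiv.Perm.mul_apply, Equiv.swap_apply_def, Fin.ext_iff]
    split_ifs <;> simp_all

lemma step_apply_self (hn : 3 ≤ n) {k : Fin n} (hk : 3 ≤ (k : ℕ)) :
    step hn k k = pivot hn := by
  unfold step perm12 pivot
  rw [if_neg (by omega), if_neg (by omega)]
  simp only [Equiv.Perm.mul_apply, Equiv.swap_apply_right]
  apply Equiv.swap_apply_of_ne_of_ne <;> simp [Fin.ext_iff]

lemma step_apply_of_ne (hn : 3 ≤ n) {k q : Fin n} (hq : 3 ≤ (q : ℕ)) (h : q ≠ k) :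
    step hn k q = q := by
  have h0 : ∀ m (hm : m < n), m < 3 → q ≠ ⟨m, hm⟩ := fun m hm h3 e => by
    simp [Fin.ext_iff] at e; omega
  have h1 := fun hm => h0 0 hm (by norm_num)
  have h2 := fun hm => h0 1 hm (by norm_num)
  have h3 := fun hm => h0 2 hm (by norm_num)
  unfold step perm123 perm132 perm12 pivot
  split_ifs <;> simp only [Equiv.Perm.mul_apply]
  · rw [Equiv.swap_apply_of_ne_of_ne (h1 _) (h2 _), Equiv.swap_apply_of_ne_of_ne (h1 _) (h3 _)]
  · rw [Equiv.swap_apply_of_ne_of_ne (h1 _) (h3 _), Equiv.swap_apply_of_ne_of_ne (h1 _) (h2 _)]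
  · rw [Equiv.swap_apply_of_ne_of_ne (h3 _) h, Equiv.swap_apply_of_ne_of_ne (h1 _) (h2 _)]

lemma sign_step (hn : 3 ≤ n) {k : Fin n} (hk : k ≠ pivot hn) :
    Equiv.Perm.sign (step hn k) = 1 := by
  have e01 : (⟨0, by omega⟩ : Fin n) ≠ ⟨1, by omega⟩ := by simp
  have e02 : (⟨0, by omega⟩ : Fin n) ≠ ⟨2, by omega⟩ := by simp
  unfold step perm123 perm132 perm12
  split_ifs <;>
    simp [Equiv.Perm.sign_swap e01, Equiv.Perm.sign_swap e02, Equiv.Perm.sign_swap hk.symm]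

/-- The neighbour of `u` whose pivot symbol is `i`. -/
def nb (hn : 3 ≤ n) (u : Equiv.Perm (Fin n)) (i : Fin n) : Equiv.Perm (Fin n) :=
  u * step hn (u.symm i)

/-- Permutations of equal sign that agree from the pivot on are equal. -/
lemma eq_of_agree (hn : 3 ≤ n) {u w : Equiv.Perm (Fin n)}
    (hs : Equiv.Perm.sign u = Equiv.Perm.sign w)
    (h : ∀ q : Fin n, 2 ≤ (q : ℕ) → u q = w q) : u = w := by
  let a : Fin n := ⟨0, by omega⟩
  let b : Fin n := ⟨1, by omega⟩
  have hab : a ≠ b := by simp [a, b]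
  have key : ∀ q, q = a ∨ q = b ∨ 2 ≤ (q : ℕ) := fun q => by
    simp only [a, b, Fin.ext_iff]; omega
  have hinj : ∀ r, w r = u a → r = a ∨ r = b := fun r hr => by
    rcases key r with h1 | h1 | h1
    · exact Or.inl h1
    · exact Or.inr h1
    · left; rw [← h r h1] at hr; exact u.injective hr
  have hinj' : ∀ r, w r = u b → r = a ∨ r = b := fun r hr => by
    rcases key r with h1 | h1 | h1
    · exact Or.inl h1
    · exact Or.inr h1
    · right; rw [← h r h1] at hr; exact u.injective hr
  obtain ⟨ra, hra⟩ := w.surjective (u a)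
  obtain ⟨rb, hrb⟩ := w.surjective (u b)
  have hne : ra ≠ rb := fun e => hab (u.injective (by rw [← hra, ← hrb, e]))
  rcases hinj ra hra with rfl | rfl
  · rcases hinj' rb hrb with rfl | rfl
    · exact absurd rfl hne
    · ext q : 1
      rcases key q with rfl | rfl | hq
      · exact hra.symm
      · exact hrb.symm
      · exact h q hq
  · rcases hinj' rb hrb with rfl | rfl
    · exfalso
      have : u = w * Equiv.swap a b := by
        ext q : 1
        rcases key q with rfl | rfl | hq
        · simp [hra]
        · simp [hrb]
        · rw [Equiv.Perm.mul_apply, Equiv.swap_apply_of_ne_of_ne, h q hq] <;>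
            intro e <;> simp [e, a, b] at hq
      rw [this] at hs
      simp [Equiv.Perm.sign_swap hab] at hs
    · exact absurd rfl hne

variable (hn : 3 ≤ n)

lemma nb_pivot (u : Equiv.Perm (Fin n)) (i : Fin n) : nb hn u i (pivot hn) = i := by
  simp [nb, step_pivot]

lemma nb_apply_of_ne {u : Equiv.Perm (Fin n)} {i q : Fin n} (hq : 3 ≤ (q : ℕ)) (h : u q ≠ i) :
    nb hn u i q = u q := by
  have : q ≠ u.symm i := fun e => h (by rw [e]; simp)
  simp [nb, step_apply_of_ne hn hq this]

lemma nb_apply_self (u : Equiv.Perm (Fin n)) {q : Fin n} (hq : 3 ≤ (q : ℕ)) :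
    nb hn u (u q) q = u (pivot hn) := by
  simp [nb, step_apply_self hn hq]

lemma sign_nb {u : Equiv.Perm (Fin n)} {i : Fin n} (h : i ≠ u (pivot hn)) :
    Equiv.Perm.sign (nb hn u i) = Equiv.Perm.sign u := by
  have : u.symm i ≠ pivot hn := fun e => h (by rw [← e]; simp)
  simp [nb, sign_step hn this]

lemma nb_nb {u : Equiv.Perm (Fin n)} {i : Fin n} (hi : i ≠ u (pivot hn)) :
    nb hn (nb hn u i) (u (pivot hn)) = u := by
  have h1 : u (pivot hn) ≠ nb hn u i (pivot hn) := by rw [nb_pivot]; exact hi.symm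
  refine eq_of_agree hn ((sign_nb hn h1).trans (sign_nb hn hi)) fun q hq => ?_
  rcases Nat.eq_or_lt_of_le hq with h2 | h3
  · have : q = pivot hn := Fin.ext h2.symm
    rw [this, nb_pivot]
  · by_cases hqi : u q = i
    · have h4 : nb hn u i q = u (pivot hn) := by rw [← hqi]; exact nb_apply_self hn u h3
      have := nb_apply_self hn (nb hn u i) h3
      rw [h4, nb_pivot] at this
      rw [this, hqi]
    · have h4 := nb_apply_of_ne hn h3 hqi
      rw [nb_apply_of_ne hn h3, h4]
      rw [h4]
      intro e
      have := u.injective e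
      simp [this, pivot] at h3

/-- The alternating group network on each parity class: the godan graph without its `(12)`-edges. -/
def altGraph : SimpleGraph (Equiv.Perm (Fin n)) where
  Adj a b := a (pivot hn) ≠ b (pivot hn) ∧ b = nb hn a (b (pivot hn))
  symm := ⟨fun _ _ ⟨h, e⟩ => ⟨h.symm, by
    conv_rhs => rw [e]
    exact (nb_nb hn h.symm).symm⟩⟩
  loopless := ⟨fun _ h => h.1 rfl⟩

lemma adj_nb {u : Equiv.Perm (Fin n)} {i : Fin n} (hi : i ≠ u (pivot hn)) :
    (altGraph hn).Adj u (nb hn u i) :=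
  ⟨by rw [nb_pivot]; exact hi.symm, by rw [nb_pivot]⟩

/-- Distinct permutations of equal sign that agree after the pivot are adjacent. -/
lemma adj_of_agree {t u : Equiv.Perm (Fin n)}
    (hs : Equiv.Perm.sign t = Equiv.Perm.sign u) (hne : t ≠ u)
    (h : ∀ q : Fin n, 3 ≤ (q : ℕ) → t q = u q) : (altGraph hn).Adj t u := by
  have hsplit : ∀ q : Fin n, 2 ≤ (q : ℕ) → q = pivot hn ∨ 3 ≤ (q : ℕ) := fun q hq => by
    rcases Nat.eq_or_lt_of_le hq with h | h
    · exact Or.inl (Fin.ext h.symm)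
    · exact Or.inr h
  have hpv : t (pivot hn) ≠ u (pivot hn) := fun e => hne <| eq_of_agree hn hs fun q hq => by
    rcases hsplit q hq with rfl | h3
    · exact e
    · exact h q h3
  refine ⟨hpv, eq_of_agree hn ((sign_nb hn hpv.symm).trans hs).symm fun q hq => ?_⟩
  rcases hsplit q hq with rfl | h3
  · rw [nb_pivot]
  · rw [nb_apply_of_ne hn h3, h q h3]
    rw [h q h3]
    intro e
    have := u.injective e
    simp [this, pivot] at h3

lemma sign_eq_of_adj {a b : Equiv.Perm (Fin n)} (h : (altGraph hn).Adj a b) :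
    Equiv.Perm.sign b = Equiv.Perm.sign a := by
  rw [h.2]; exact sign_nb hn h.1.symm

lemma altGraph_le : altGraph hn ≤ godanGraph n hn := fun _ _ h =>
  ⟨h.ne, Or.inr ⟨_, step_mem_OmegaStar hn _, h.2⟩⟩

lemma adj_mul_perm12 (u : Equiv.Perm (Fin n)) : (godanGraph n hn).Adj u (u * perm12 n hn) := by
  refine ⟨fun e => ?_, Or.inr ⟨_, by simp [OmegaStar], rfl⟩⟩
  have : perm12 n hn = 1 := by simpa using e
  simp [perm12, Equiv.swap_eq_one_iff] at this

end Moves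

section Connectivity

variable {n : ℕ}

lemma card_add_three_le (hn : 3 ≤ n) {P : Finset (Fin n)} (hP : ∀ q ∈ P, 3 ≤ (q : ℕ)) :
    P.card + 3 ≤ n := by
  have h : P.map Fin.valEmbedding ⊆ Finset.Ico 3 n := fun m hm => by
    obtain ⟨q, hq, rfl⟩ := Finset.mem_map.1 hm
    exact Finset.mem_Ico.2 ⟨hP q hq, q.2⟩
  have := Finset.card_le_card h
  rw [Finset.card_map, Nat.card_Ico] at this
  omega

/-- The permutations outside `D` that take the values prescribed by `g` on `P`. -/
def cell (P : Finset (Fin n)) (g : Fin n → Fin n) (D : Finset (Equiv.Perm (Fin n))) :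
    Set (Equiv.Perm (Fin n)) :=
  {u | u ∉ D ∧ ∀ q ∈ P, u q = g q}

/-- A cell in which `n - |P|` symbols are free stays connected, within one parity class, after
the deletion of at most `n - |P| - 2` vertices. -/
lemma reachable_of_cell (hn : 3 ≤ n) (k : ℕ) : ∀ (P : Finset (Fin n)) (g : Fin n → Fin n)
    (D : Finset (Equiv.Perm (Fin n))) (K : SimpleGraph (Equiv.Perm (Fin n))),
    n ≤ k + P.card → (∀ q ∈ P, 3 ≤ (q : ℕ)) → D.card + P.card + 2 ≤ n →
    (∀ a b, (altGraph hn).Adj a b → a ∈ cell P g D → b ∈ cell P g D → K.Adj a b) →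
    ∀ u u', u ∈ cell P g D → u' ∈ cell P g D → Equiv.Perm.sign u = Equiv.Perm.sign u' →
      K.Reachable u u' := by
  classical
  induction k with
  | zero => intros; omega
  | succ k ih =>
  intro P g D K hk hP hD hK u u' hu hu' hs
  by_cases hp : ∃ p : Fin n, 3 ≤ (p : ℕ) ∧ p ∉ P
  swap
  · push Not at hp
    by_cases huu : u = u'
    · rw [huu]
    · exact (hK u u' (adj_of_agree hn hs huu fun q hq =>
        (hu.2 q (hp q hq)).trans (hu'.2 q (hp q hq)).symm) hu hu').reachable
  obtain ⟨p, hp3, hpP⟩ := hp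
  have hins : ∀ q ∈ insert p P, 3 ≤ (q : ℕ) := by
    intro q hq
    rcases Finset.mem_insert.1 hq with rfl | h
    · exact hp3
    · exact hP q h
  have hcard := card_add_three_le hn hins
  rw [Finset.card_insert_of_notMem hpP] at hcard
  -- neighbours staying in the prescribed values
  have hkeep : ∀ (w : Equiv.Perm (Fin n)) i, (∀ q ∈ P, w q = g q) → (∀ q ∈ P, g q ≠ i) →
      ∀ q ∈ P, nb hn w i q = g q :=
    fun w i hw hi q hq => by
      rw [nb_apply_of_ne hn (hP q hq) (by rw [hw q hq]; exact hi q hq), hw q hq]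
  set clean : Fin n → Prop := fun i => (∀ q ∈ P, g q ≠ i) ∧ ∀ d ∈ D, d p ≠ i with hclean
  have hmem : ∀ w : Equiv.Perm (Fin n), (∀ q ∈ P, w q = g q) → clean (w p) →
      w ∈ cell P g D := fun w hw hc =>
    ⟨fun hd => hc.2 w hd rfl, hw⟩
  have hfree : ∀ w : Equiv.Perm (Fin n), (∀ q ∈ P, w q = g q) →
      ∀ q ∈ P, g q ≠ w p := fun w hw q hq e => by
    rw [← hw q hq] at e
    exact hpP (w.injective e ▸ hq)
  have hsub : ∀ w w' : Equiv.Perm (Fin n), (∀ q ∈ P, w q = g q) → (∀ q ∈ P, w' q = g q) →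
      clean (w p) → w p = w' p →
      Equiv.Perm.sign w = Equiv.Perm.sign w' → K.Reachable w w' := by
    intro w w' hw hw' hc hpp hss
    have hcell : ∀ a, a ∈ cell (insert p P) w ∅ → a ∈ cell P g D := fun a ha => by
      refine hmem a (fun q hq => ?_) ?_
      · rw [ha.2 q (Finset.mem_insert_of_mem hq), hw q hq]
      · rw [ha.2 p (Finset.mem_insert_self _ _)]; exact hc
    refine ih (insert p P) w ∅ K ?_ hins ?_ (fun a b hab ha hb => hK a b hab (hcell a ha)
      (hcell b hb)) w w' ⟨by simp, fun _ _ => rfl⟩ ⟨by simp, fun q hq => ?_⟩ hss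
    · rw [Finset.card_insert_of_notMem hpP]; omega
    · rw [Finset.card_insert_of_notMem hpP, Finset.card_empty]; omega
    · rcases Finset.mem_insert.1 hq with rfl | h
      · exact hpp.symm
      · rw [hw q h, hw' q h]
  -- an arm from `w` to the subcell `i`, avoiding `D`
  have harm : ∀ w i, w ∈ cell P g D → clean i → i ≠ w p →
      (i = w (pivot hn) ∨ nb hn w i ∉ D) → ∃ w', (∀ q ∈ P, w' q = g q) ∧ w' p = i ∧
        Equiv.Perm.sign w' = Equiv.Perm.sign w ∧ K.Reachable w w' := by
    intro w i hw hc hip hor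
    have hpne : ∀ v : Equiv.Perm (Fin n), v p ≠ v (pivot hn) := fun v e => by
      have := v.injective e
      simp [this, pivot] at hp3
    have direct : ∀ v, v ∈ cell P g D → i = v (pivot hn) → ∃ w', (∀ q ∈ P, w' q = g q) ∧
        w' p = i ∧ Equiv.Perm.sign w' = Equiv.Perm.sign v ∧ K.Reachable v w' := by
      intro v hv hiv
      have h1 : nb hn v (v p) p = i := by rw [nb_apply_self hn v hp3, hiv]
      have h2 := hkeep v (v p) hv.2 (hfree v hv.2)
      exact ⟨nb hn v (v p), h2, h1, sign_nb hn (hpne v),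
        (hK _ _ (adj_nb hn (hpne v)) hv (hmem _ h2 (by rw [h1]; exact hc))).reachable⟩
    by_cases hi : i = w (pivot hn)
    · exact direct w hw hi
    · have hD' := hor.resolve_left hi
      have hc' : nb hn w i ∈ cell P g D := ⟨hD', hkeep w i hw.2 hc.1⟩
      obtain ⟨w', h1, h2, h3, h4⟩ := direct _ hc' (nb_pivot hn w i).symm
      exact ⟨w', h1, h2, h3.trans (sign_nb hn hi), (hK _ _ (adj_nb hn hi) hw hc').reachable.trans h4⟩
  -- every vertex reaches a clean subcell
  have hreach : ∀ w ∈ cell P g D, ∃ w', (∀ q ∈ P, w' q = g q) ∧ clean (w' p) ∧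
      Equiv.Perm.sign w' = Equiv.Perm.sign w ∧ K.Reachable w w' := by
    intro w hw
    by_cases hc : clean (w p)
    · exact ⟨w, hw.2, hc, rfl, SimpleGraph.Reachable.refl _⟩
    set Dj := D.filter (fun d => d p = w p) with hDj
    set Cl := Finset.univ.filter clean with hCl
    have hdirty : Finset.univ ⊆ Cl ∪ (P.image g ∪ insert (w p) ((D \ Dj).image fun d => d p)) := by
      intro i _
      by_cases hci : clean i
      · simp [hCl, hci]
      · simp only [hclean, not_and_or, not_forall, not_not] at hci
        rcases hci with ⟨q, hq, e⟩ | ⟨d, hd, e⟩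
        · exact Finset.mem_union_right _ (Finset.mem_union_left _ (Finset.mem_image.2 ⟨q, hq, e⟩))
        · refine Finset.mem_union_right _ (Finset.mem_union_right _ ?_)
          by_cases hdp : d p = w p
          · rw [← e, hdp]; exact Finset.mem_insert_self _ _
          · refine Finset.mem_insert_of_mem (Finset.mem_image.2 ⟨d, ?_, e⟩)
            simp [hDj, hd, hdp]
    have hcount : Dj.card < Cl.card := by
      have h1 := Finset.card_le_card hdirty
      rw [Finset.card_univ, Fintype.card_fin] at h1
      have h2 := Finset.card_union_le Cl (P.image g ∪ insert (w p) ((D \ Dj).image fun d => d p))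
      have h3 := Finset.card_union_le (P.image g) (insert (w p) ((D \ Dj).image fun d => d p))
      have h4 := Finset.card_insert_le (w p) ((D \ Dj).image fun d => d p)
      have h5 := Finset.card_image_le (s := D \ Dj) (f := fun d => d p)
      have h6 := Finset.card_image_le (s := P) (f := g)
      have h7 := Finset.card_sdiff_add_card_eq_card (Finset.filter_subset (fun d => d p = w p) D)
      rw [← hDj] at h7
      omega
    have hex : ∃ i, clean i ∧ (i = w (pivot hn) ∨ nb hn w i ∉ D) := by
      by_contra hno
      push Not at hno
      refine absurd (Finset.card_le_card_of_injOn (s := Cl) (t := Dj) (nb hn w) (fun i hi => ?_)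
        fun i _ j _ e => ?_) (by omega)
      · have hci : clean i := (Finset.mem_filter.1 hi).2
        refine Finset.mem_filter.2 ⟨(hno i hci).2, nb_apply_of_ne hn hp3 fun e => hc (e ▸ hci)⟩
      · have := congrArg (fun v => v (pivot hn)) e
        simpa [nb_pivot] using this
    obtain ⟨i, hci, hor⟩ := hex
    obtain ⟨w', h1, h2, h3, h4⟩ := harm w i hw hci (fun e => hc (e ▸ hci)) hor
    exact ⟨w', h1, by rw [h2]; exact hci, h3, h4⟩
  obtain ⟨w, hw, hc, hs1, hr1⟩ := hreach u hu
  obtain ⟨w', hw', hc', hs2, hr2⟩ := hreach u' hu'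
  by_cases hpp : w p = w' p
  · exact (hr1.trans (hsub w w' hw hw' hc hpp (by rw [hs1, hs2, hs]))).trans hr2.symm
  · have hor : w' p = w (pivot hn) ∨ nb hn w (w' p) ∉ D := Or.inr fun hd =>
      hc.2 _ hd (nb_apply_of_ne hn hp3 hpp)
    obtain ⟨v, h1, h2, h3, h4⟩ := harm w (w' p) (hmem w hw hc) hc' (Ne.symm hpp) hor
    exact ((hr1.trans h4).trans (hsub v w' h1 hw' (by rw [h2]; exact hc') h2
      (by rw [h3, hs1, hs2, hs]))).trans hr2.symm

end Connectivity

section Colouring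

variable {V γ : Type*}

/-- The part of `G` of colour `i`: vertices outside `S` are coloured by `col`, the vertices in `S`
carry every colour, and the edges inside `S` are coloured by `κ`. -/
def colGraph (G : SimpleGraph V) (S : Set V) (col : V → γ) (κ : V → V → γ) (i : γ) :
    SimpleGraph V where
  Adj a b := G.Adj a b ∧ (a ∈ S ∨ col a = i) ∧ (b ∈ S ∨ col b = i) ∧
    (a ∈ S → b ∈ S → κ a b = i ∧ κ b a = i)
  symm := ⟨fun _ _ ⟨h1, h2, h3, h4⟩ => ⟨h1.symm, h3, h2, fun hb ha => (h4 ha hb).symm⟩⟩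
  loopless := ⟨fun _ h => h.1.ne rfl⟩

/-- A connected set of vertices spans a subtree. -/
lemma exists_tree_of_reachable {G H : SimpleGraph V} (hHG : H ≤ G) (s : V) :
    ∃ T : G.Subgraph, T.verts = {u | H.Reachable s u} ∧ T.coe.IsTree ∧
      ∀ a b, T.Adj a b → H.Adj a b := by
  let C := H.connectedComponentMk s
  obtain ⟨T, hT, htree⟩ := C.connected_toSimpleGraph.exists_isTree_le
  have hmem : ∀ u, u ∈ C.supp ↔ H.Reachable s u := fun u => by
    rw [SimpleGraph.ConnectedComponent.mem_supp_iff, SimpleGraph.ConnectedComponent.eq]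
    exact ⟨fun h => h.symm, fun h => h.symm⟩
  let T' : G.Subgraph :=
    { verts := C.supp
      Adj := fun a b => ∃ (ha : a ∈ C.supp) (hb : b ∈ C.supp), T.Adj ⟨a, ha⟩ ⟨b, hb⟩
      adj_sub := fun ⟨_, _, h⟩ => hHG (hT h)
      edge_vert := fun ⟨ha, _, _⟩ => ha
      symm := ⟨fun _ _ ⟨ha, hb, h⟩ => ⟨hb, ha, h.symm⟩⟩ }
  refine ⟨T', Set.ext hmem, ?_, fun a b ⟨_, _, h⟩ => hT h⟩
  have : T'.coe = T := by
    ext a b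
    exact ⟨fun ⟨_, _, h⟩ => h, fun h => ⟨a.2, b.2, h⟩⟩
  rw [this]
  exact htree

lemma exists_isIDSTFamily {G : SimpleGraph V} {S : Set V} {col : V → γ} {κ : V → V → γ} {s : V}
    (hs : s ∈ S) {r : ℕ} {J : Fin r → γ} (hJ : Function.Injective J)
    (h : ∀ j, ∀ u ∈ S, (colGraph G S col κ (J j)).Reachable s u) :
    ∃ T : Fin r → G.Subgraph, IsIDSTFamily G S T := by
  have hle : ∀ j, colGraph G S col κ (J j) ≤ G := fun j _ _ hab => hab.1
  choose T hverts htree hadj using fun j => exists_tree_of_reachable (hle j) s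
  have hcol : ∀ j, ∀ u ∈ (T j).verts, u ∈ S ∨ col u = J j := by
    intro j u hu
    rw [hverts] at hu
    obtain ⟨p⟩ := hu.symm
    cases p with
    | nil => exact Or.inl hs
    | cons hab _ => exact hab.2.1
  have hinter : ∀ i j, i ≠ j → ∀ u ∈ (T i).verts, u ∈ (T j).verts → u ∈ S := by
    intro i j hij u hi hj
    rcases hcol i u hi with h1 | h1
    · exact h1
    rcases hcol j u hj with h2 | h2
    · exact h2
    exact absurd (hJ (h1.symm.trans h2)) hij
  refine ⟨T, fun j => ⟨fun u hu => by rw [hverts]; exact h j u hu, htree j⟩, fun i j hij => ⟨?_, ?_⟩⟩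
  · refine Set.Subset.antisymm (fun u hu => hinter i j hij u hu.1 hu.2) fun u hu => ⟨?_, ?_⟩ <;>
      rw [hverts] <;> exact h _ u hu
  · rw [Set.eq_empty_iff_forall_notMem]
    intro e
    induction e with | _ a b
    rintro ⟨h1, h2⟩
    rw [SimpleGraph.Subgraph.mem_edgeSet] at h1 h2
    have ha := hinter i j hij a h1.fst_mem h2.fst_mem
    have hb := hinter i j hij b h1.snd_mem h2.snd_mem
    exact hij (hJ (((hadj _ _ _ h1).2.2.2 ha hb).1.symm.trans ((hadj _ _ _ h2).2.2.2 ha hb).1))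

end Colouring

section Assembly

variable {n : ℕ}

lemma reachable_of_invariant {V : Type*} {H K : SimpleGraph V} {P : V → Prop}
    (h : ∀ a b, P a → H.Adj a b → P b ∧ K.Adj a b) {a b : V} (ha : P a) (hab : H.Reachable a b) :
    K.Reachable a b := by
  obtain ⟨p⟩ := hab
  induction p with
  | nil => exact SimpleGraph.Reachable.refl _
  | cons hadj _ ih => exact (h _ _ ha hadj).2.reachable.trans (ih (h _ _ ha hadj).1)

lemma perm12_mul_self (hn : 3 ≤ n) : perm12 n hn * perm12 n hn = 1 :=
  Equiv.swap_mul_self _ _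

lemma sign_mul_perm12 (hn : 3 ≤ n) (u : Equiv.Perm (Fin n)) :
    Equiv.Perm.sign (u * perm12 n hn) = -Equiv.Perm.sign u := by
  have e01 : (⟨0, by omega⟩ : Fin n) ≠ ⟨1, by omega⟩ := by simp
  simp [perm12, Equiv.Perm.sign_swap e01]

lemma adj_mul_perm12_mul_perm12 (hn : 3 ≤ n) {a b : Equiv.Perm (Fin n)}
    (h : (altGraph hn).Adj a b) :
    (altGraph hn).Adj (a * perm12 n hn) (b * perm12 n hn) := by
  have hfix : ∀ u : Equiv.Perm (Fin n), ∀ q : Fin n, 2 ≤ (q : ℕ) → (u * perm12 n hn) q = u q := by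
    intro u q hq
    rw [Equiv.Perm.mul_apply, perm12, Equiv.swap_apply_of_ne_of_ne] <;>
      · rintro rfl
        simp at hq
  have hpiv := fun u => hfix u (pivot hn) le_rfl
  refine ⟨by rw [hpiv, hpiv]; exact h.1, eq_of_agree hn ?_ fun q hq => ?_⟩
  · rw [sign_nb hn (by rw [hpiv, hpiv]; exact h.1.symm), sign_mul_perm12, sign_mul_perm12,
      sign_eq_of_adj hn h]
  · rw [hfix b q hq, hpiv]
    rcases Nat.eq_or_lt_of_le hq with h2 | h3
    · rw [show q = pivot hn from Fin.ext h2.symm, nb_pivot]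
    · conv_lhs => rw [h.2]
      by_cases hqb : a q = b (pivot hn)
      · rw [← hqb, nb_apply_self hn a h3, ← hfix a q hq, nb_apply_self hn _ h3, hpiv]
      · rw [nb_apply_of_ne hn h3 hqb, nb_apply_of_ne hn h3 (by rwa [hfix a q hq]), hfix a q hq]

/-- A colouring of the even layer in which `n - 2` colours connect `S` to a vertex that is `v` or a
neighbour of `v`. -/
def HasColouring (hn : 3 ≤ n) (S : Set (Equiv.Perm (Fin n))) (v : Equiv.Perm (Fin n)) : Prop :=
  ∃ (I : Finset (Fin n)) (col : Equiv.Perm (Fin n) → Fin n)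
    (κ : Equiv.Perm (Fin n) → Equiv.Perm (Fin n) → Fin n), I.card = n - 2 ∧
    ∀ i ∈ I, ∃ g ∉ S, col g = i ∧ (g = v ∨ (altGraph hn).Adj v g) ∧
      ∀ s ∈ S, (colGraph (altGraph hn) S col κ i).Reachable s g

/-- The remaining tree uses the odd layer. -/
lemma HasColouring.exists_isIDSTFamily {hn : 3 ≤ n} {S : Set (Equiv.Perm (Fin n))}
    {v : Equiv.Perm (Fin n)} (h : HasColouring hn S v) (hS : ∀ s ∈ S, Equiv.Perm.sign s = 1)
    (hv : Equiv.Perm.sign v = 1) (hvS : v ∉ S) :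
    ∃ T : Fin (n - 1) → (godanGraph n hn).Subgraph,
      IsIDSTFamily (godanGraph n hn) (insert (v * perm12 n hn) S) T := by
  classical
  obtain ⟨I, col, κ, hI, h⟩ := h
  choose! g hgS hgcol hgv hreach using h
  set c := perm12 n hn with hc
  have hcc : ∀ u, u * c * c = u := fun u => by rw [mul_assoc, hc, perm12_mul_self, mul_one]
  have hodd : ∀ u, Equiv.Perm.sign u = 1 → Equiv.Perm.sign (u * c) = -1 := fun u hu => by
    rw [hc, sign_mul_perm12, hu]
  have h11 : (-1 : ℤˣ) ≠ 1 := by decide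
  set w := v * c with hw
  set S' := insert w S with hS'
  have heven : ∀ u, Equiv.Perm.sign u = 1 → (u ∈ S' ↔ u ∈ S) := fun u hu => by
    rw [hS', Set.mem_insert_iff, or_iff_right]
    rintro rfl
    exact h11 ((hodd v hv).symm.trans hu)
  have hnot : ∀ u, Equiv.Perm.sign u = -1 → (u ∈ S' ↔ u = w) := fun u hu => by
    rw [hS', Set.mem_insert_iff, or_iff_left]
    intro hus
    exact h11 (hu.symm.trans (hS u hus))
  have hgeven : ∀ i ∈ I, Equiv.Perm.sign (g i) = 1 := fun i hi => by
    rcases hgv i hi with h | h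
    · rw [h, hv]
    · rw [sign_eq_of_adj hn h, hv]
  set D : Finset (Equiv.Perm (Fin n)) := (I.filter fun i => g i ≠ v).image fun i => g i * c with hD
  have hmemD : ∀ u, u * c ∈ D ↔ ∃ i ∈ I, g i ≠ v ∧ g i = u := fun u => by
    simp [hD, and_assoc]
  let Col : Equiv.Perm (Fin n) → Option (Fin n) := fun u =>
    if Equiv.Perm.sign u = 1 then some (col u) else if u ∈ D then some (col (u * c)) else none
  let κ' : Equiv.Perm (Fin n) → Equiv.Perm (Fin n) → Option (Fin n) := fun a b => some (κ a b)
  have hJcard : (insert none (I.map Function.Embedding.some)).card = n - 1 := by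
    rw [Finset.card_insert_of_notMem (by simp), Finset.card_map, hI]; omega
  let e := Finset.equivFinOfCardEq hJcard
  refine Godan.exists_isIDSTFamily (col := Col) (κ := κ') (Set.mem_insert w S)
    (J := fun j => (e.symm j : Option (Fin n))) (fun a b hab => e.symm.injective (Subtype.ext hab))
    fun j => ?_
  have hj := (e.symm j).2
  generalize (e.symm j : Option (Fin n)) = o at hj
  show ∀ u ∈ S', (colGraph (godanGraph n hn) S' Col κ' o).Reachable w u
  suffices hS2 : ∀ u ∈ S, (colGraph (godanGraph n hn) S' Col κ' o).Reachable w u by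
    rintro u (rfl | hu)
    · exact SimpleGraph.Reachable.refl _
    · exact hS2 u hu
  intro u hu
  have hwS' : w ∈ S' := Set.mem_insert _ _
  rcases Finset.mem_insert.1 hj with rfl | hj
  · have hDcard : D.card ≤ n - 2 := by
      rw [← hI]
      exact Finset.card_image_le.trans (Finset.card_filter_le _ _)
    have hw' : w ∉ D := fun hd => by
      obtain ⟨i, -, h1, h2⟩ := (hmemD v).1 hd
      exact h1 h2
    have hu' : u * c ∉ D := fun hd => by
      obtain ⟨i, hi, -, h2⟩ := (hmemD u).1 hd
      exact hgS i hi (h2 ▸ hu)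
    have hCol : ∀ a, Equiv.Perm.sign a = -1 → a ∉ D → Col a = none := fun a ha had => by
      simp only [Col]
      rw [if_neg (by rw [ha]; exact h11), if_neg had]
    let K : SimpleGraph (Equiv.Perm (Fin n)) :=
      { Adj := fun a b => (altGraph hn).Adj a b ∧ a ∉ D ∧ b ∉ D
        symm := ⟨fun _ _ h => ⟨h.1.symm, h.2.2, h.2.1⟩⟩
        loopless := ⟨fun _ h => h.1.ne rfl⟩ }
    have h1 : K.Reachable w (u * c) := by
      refine reachable_of_cell hn n ∅ id D K (by simp) (by simp)
        (by rw [Finset.card_empty]; omega) (fun a b hab ha hb => ⟨hab, ha.1, hb.1⟩) _ _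
        ⟨hw', by simp⟩ ⟨hu', by simp⟩ ?_
      rw [hodd v hv, hodd u (hS u hu)]
    refine (reachable_of_invariant (P := fun a => Equiv.Perm.sign a = -1) (fun a b ha hab => ?_)
      (hodd v hv) h1).trans ?_
    · have hb : Equiv.Perm.sign b = -1 := (sign_eq_of_adj hn hab.1).trans ha
      refine ⟨hb, altGraph_le hn hab.1, Or.inr (hCol a ha hab.2.1), Or.inr (hCol b hb hab.2.2),
        fun ha' hb' => ?_⟩
      rw [hnot a ha] at ha'
      rw [hnot b hb] at hb'
      exact absurd (ha'.trans hb'.symm) hab.1.ne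
    · refine SimpleGraph.Adj.reachable ⟨(adj_mul_perm12 hn u).symm,
        Or.inr (hCol _ (hodd u (hS u hu)) hu'), Or.inl (Set.mem_insert_of_mem _ hu), fun h2 => ?_⟩
      rw [hnot _ (hodd u (hS u hu)), hw, mul_left_inj] at h2
      exact absurd (h2 ▸ hu) hvS
  · obtain ⟨i, hi, rfl⟩ := Finset.mem_map.1 hj
    have hCol : ∀ a, Equiv.Perm.sign a = 1 → Col a = some (col a) := fun a ha => if_pos ha
    have h1 : (colGraph (godanGraph n hn) S' Col κ' (some i)).Reachable u (g i) := by
      refine reachable_of_invariant (P := fun a => Equiv.Perm.sign a = 1) (fun a b ha hab => ?_)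
        (hS u hu) (hreach i hi u hu)
      have hb : Equiv.Perm.sign b = 1 := (sign_eq_of_adj hn hab.1).trans ha
      refine ⟨hb, altGraph_le hn hab.1, ?_, ?_, fun ha' hb' => ?_⟩
      · rw [heven a ha, hCol a ha, Option.some_inj]; exact hab.2.1
      · rw [heven b hb, hCol b hb, Option.some_inj]; exact hab.2.2.1
      · rw [heven a ha] at ha'
        rw [heven b hb] at hb'
        simpa [κ'] using hab.2.2.2 ha' hb'
    have hg := hgeven i hi
    have hgS' : g i ∉ S' := by rw [heven _ hg]; exact hgS i hi
    have hgCol : Col (g i) = some i := by rw [hCol _ hg, hgcol i hi]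
    refine SimpleGraph.Reachable.symm (h1.trans ?_)
    by_cases hgi : g i = v
    · rw [hgi] at hgS' hgCol ⊢
      exact SimpleGraph.Adj.reachable ⟨adj_mul_perm12 hn v, Or.inr hgCol, Or.inl hwS',
        fun h => absurd h hgS'⟩
    · have hgD : g i * c ∈ D := (hmemD _).2 ⟨i, hi, hgi, rfl⟩
      have hgcCol : Col (g i * c) = some i := by
        simp only [Col]
        rw [if_neg (by rw [hodd _ hg]; exact h11), if_pos hgD, hcc, hgcol i hi]
      have hgcS : g i * c ∉ S' := by
        rw [hnot _ (hodd _ hg), hw, mul_left_inj]; exact hgi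
      have hvg := (hgv i hi).resolve_left hgi
      have h2 : (colGraph (godanGraph n hn) S' Col κ' (some i)).Adj (g i) (g i * c) :=
        ⟨adj_mul_perm12 hn (g i), Or.inr hgCol, Or.inr hgcCol, fun h => absurd h hgS'⟩
      have h3 : (colGraph (godanGraph n hn) S' Col κ' (some i)).Adj (g i * c) w :=
        ⟨altGraph_le hn (adj_mul_perm12_mul_perm12 hn hvg).symm, Or.inr hgcCol, Or.inl hwS',
          fun h => absurd h hgcS⟩
      exact h2.reachable.trans h3.reachable

end Assembly

section Layouts

variable {n : ℕ}

/-- The data of a colouring of the even layer that is organised by the symbol in position `p`.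
A neighbour `u` of a terminal `t` in the same copy as `t` is a port, and is coloured by its pivot
symbol, if `act` allows it; the other vertices of copy `c` get the colour `φ c`. -/
structure Layout (n : ℕ) where
  hn : 3 ≤ n
  p : Fin n
  three_le : 3 ≤ (p : ℕ)
  S : Set (Equiv.Perm (Fin n))
  v : Equiv.Perm (Fin n)
  sign_eq_one : ∀ t ∈ insert v S, Equiv.Perm.sign t = 1
  notMem : v ∉ S
  act : Fin n → Fin n → Prop
  φ : Fin n → Fin n
  κ : Equiv.Perm (Fin n) → Equiv.Perm (Fin n) → Fin n

namespace Layout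

variable (L : Layout n)

/-- The symbol in the pivot position. -/
def piv (u : Equiv.Perm (Fin n)) : Fin n := u (pivot L.hn)

/-- The neighbour of `u` outside its copy. -/
def ext (u : Equiv.Perm (Fin n)) : Equiv.Perm (Fin n) := nb L.hn u (u L.p)

/-- `u` is a neighbour of a terminal of its copy and may be used for the colour `L.piv u`. -/
def IsPort (u : Equiv.Perm (Fin n)) : Prop :=
  ∃ t ∈ insert L.v L.S, t L.p = u L.p ∧ (altGraph L.hn).Adj t u ∧ L.act (u L.p) (L.piv u)

open Classical in
/-- The colour of a vertex outside `S`. -/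
noncomputable def col (u : Equiv.Perm (Fin n)) : Fin n :=
  if L.IsPort u then L.φ (L.piv u) else L.φ (u L.p)

/-- The vertices of copy `c` that are not ports. -/
def body (c : Fin n) : Set (Equiv.Perm (Fin n)) :=
  {u | Equiv.Perm.sign u = 1 ∧ u L.p = c ∧ ¬ L.IsPort u}

/-- The part of colour `i`. -/
noncomputable def H (i : Fin n) : SimpleGraph (Equiv.Perm (Fin n)) :=
  colGraph (altGraph L.hn) L.S L.col L.κ i

/-- `u` is joined to the body of copy `c` within the colour of that body. -/
def Good (c : Fin n) (u : Equiv.Perm (Fin n)) : Prop :=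
  ∃ w ∈ L.body c, (L.H (L.φ c)).Reachable u w

variable {L}

lemma apply_ne_piv (u : Equiv.Perm (Fin n)) : u L.p ≠ L.piv u := fun e => by
  have h3 := L.three_le
  rw [u.injective e] at h3
  simp [pivot] at h3

lemma ext_apply (u : Equiv.Perm (Fin n)) : L.ext u L.p = L.piv u :=
  nb_apply_self L.hn u L.three_le

lemma piv_ext (u : Equiv.Perm (Fin n)) : L.piv (L.ext u) = u L.p := nb_pivot _ _ _

lemma adj_ext (u : Equiv.Perm (Fin n)) : (altGraph L.hn).Adj u (L.ext u) :=
  adj_nb L.hn (apply_ne_piv u)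

lemma piv_nb (u : Equiv.Perm (Fin n)) (i : Fin n) : L.piv (nb L.hn u i) = i := nb_pivot _ _ _

lemma nb_apply {u : Equiv.Perm (Fin n)} {i : Fin n} (h : i ≠ u L.p) :
    nb L.hn u i L.p = u L.p := nb_apply_of_ne L.hn L.three_le h.symm

lemma eq_nb (L : Layout n) {t u : Equiv.Perm (Fin n)} (h : (altGraph L.hn).Adj t u) :
    u = nb L.hn t (L.piv u) := h.2

lemma col_of_mem_body {c : Fin n} {u : Equiv.Perm (Fin n)} (h : u ∈ L.body c) :
    L.col u = L.φ c := by rw [col, if_neg h.2.2, h.2.1]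

lemma good_of_mem_body {c : Fin n} {u : Equiv.Perm (Fin n)} (h : u ∈ L.body c) : L.Good c u :=
  ⟨u, h, SimpleGraph.Reachable.refl _⟩

lemma Good.of_adj {c : Fin n} {t u : Equiv.Perm (Fin n)} (h : L.Good c u)
    (htu : (L.H (L.φ c)).Adj t u) : L.Good c t := by
  obtain ⟨w, hw, hr⟩ := h
  exact ⟨w, hw, htu.reachable.trans hr⟩

/-- If copy `c` has at most one terminal, its body is connected. -/
lemma reachable_of_mem_body {c : Fin n}
    (huniq : ∀ t ∈ insert L.v L.S, ∀ t' ∈ insert L.v L.S, t L.p = c → t' L.p = c → t = t')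
    {A : Finset (Fin n)} (hA : A.card + 3 ≤ n) (hact : ∀ i, L.act c i → i ≠ c → i ∈ A)
    {u u' : Equiv.Perm (Fin n)} (hu : u ∈ L.body c) (hu' : u' ∈ L.body c) :
    (L.H (L.φ c)).Reachable u u' := by
  classical
  obtain ⟨D, hDcard, hD⟩ : ∃ D : Finset (Equiv.Perm (Fin n)), D.card ≤ A.card ∧
      ∀ w, w L.p = c → (w ∈ D ↔ L.IsPort w) := by
    have hcard : (Finset.univ.filter fun w => w L.p = c ∧ L.IsPort w).card ≤ A.card := by
      refine Finset.card_le_card_of_injOn L.piv (fun w hw => ?_) fun w hw w' hw' e => ?_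
      · obtain ⟨hwc, t, -, -, -, h⟩ := (Finset.mem_filter.1 hw).2
        rw [hwc] at h
        exact hact _ h fun e => apply_ne_piv w (hwc.trans e.symm)
      · obtain ⟨hwc, t, ht, htp, hadj, -⟩ := (Finset.mem_filter.1 hw).2
        obtain ⟨hwc', t', ht', htp', hadj', -⟩ := (Finset.mem_filter.1 hw').2
        rw [L.eq_nb hadj, L.eq_nb hadj', e, huniq t ht t' ht' (htp.trans hwc) (htp'.trans hwc')]
    exact ⟨_, hcard, fun w hw => by simp [hw]⟩
  refine reachable_of_cell L.hn n {L.p} (fun _ => c) D _ (by simp)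
    (by simpa using L.three_le) (by rw [Finset.card_singleton]; omega) (fun a b hab ha hb => ?_)
    u u' ⟨fun h => hu.2.2 ((hD u hu.2.1).1 h), by simpa using hu.2.1⟩
    ⟨fun h => hu'.2.2 ((hD u' hu'.2.1).1 h), by simpa using hu'.2.1⟩ (hu.1.trans hu'.1.symm)
  have hcol : ∀ w, w ∈ cell {L.p} (fun _ => c) D → w L.p = c ∧ L.col w = L.φ c := fun w hw => by
    have hwc : w L.p = c := by simpa using hw.2
    rw [col, if_neg fun h => hw.1 ((hD w hwc).2 h), hwc]
    exact ⟨rfl, rfl⟩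
  refine ⟨hab, Or.inr (hcol a ha).2, Or.inr (hcol b hb).2, fun h1 h2 => ?_⟩
  exact absurd (huniq a (Set.mem_insert_of_mem _ h1) b (Set.mem_insert_of_mem _ h2)
    (hcol a ha).1 (hcol b hb).1) hab.ne

/-- Copy `c` has no port whose pivot symbol is `j`. -/
def Clear (L : Layout n) (c j : Fin n) : Prop :=
  ¬ L.act c j ∨ ∀ t ∈ insert L.v L.S, t L.p ≠ c

lemma ext_mem_body {u : Equiv.Perm (Fin n)} (hu : Equiv.Perm.sign u = 1)
    (h : L.Clear (L.piv u) (u L.p)) : L.ext u ∈ L.body (L.piv u) := by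
  refine ⟨(sign_nb L.hn (apply_ne_piv u)).trans hu, ext_apply u, ?_⟩
  rintro ⟨t, ht, htp, -, hact⟩
  rw [ext_apply] at htp hact
  rw [piv_ext] at hact
  rcases h with h | h
  · exact h hact
  · exact h t ht htp

lemma good_of_ext {u : Equiv.Perm (Fin n)} (hu : Equiv.Perm.sign u = 1)
    (h : L.Clear (L.piv u) (u L.p)) (hcol : u ∈ L.S ∨ L.col u = L.φ (L.piv u))
    (hκ : u ∈ L.S → L.ext u ∈ L.S →
      L.κ u (L.ext u) = L.φ (L.piv u) ∧ L.κ (L.ext u) u = L.φ (L.piv u)) :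
    L.Good (L.piv u) u :=
  have hb := ext_mem_body hu h
  (good_of_mem_body hb).of_adj ⟨adj_ext u, hcol, Or.inr (col_of_mem_body hb), hκ⟩

/-- The arm of a terminal through a port. -/
lemma good_port {t : Equiv.Perm (Fin n)} (ht : t ∈ insert L.v L.S) {i : Fin n}
    (hp : i ≠ t L.p) (hpiv : i ≠ L.piv t) (hact : L.act (t L.p) i) (h : L.Clear i (t L.p))
    (hS : nb L.hn t i ∉ L.S) :
    L.col (nb L.hn t i) = L.φ i ∧ L.Good i (nb L.hn t i) ∧ (t ∈ L.S → L.Good i t) := by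
  have hadj := adj_nb L.hn hpiv
  have hport : L.IsPort (nb L.hn t i) := ⟨t, ht, (nb_apply hp).symm, hadj, by
    rwa [nb_apply hp, piv_nb]⟩
  have hcol : L.col (nb L.hn t i) = L.φ i := by rw [col, if_pos hport, piv_nb]
  have hgood : L.Good i (nb L.hn t i) := by
    have := good_of_ext (L := L) (u := nb L.hn t i)
      ((sign_nb L.hn hpiv).trans (L.sign_eq_one t ht)) (by rwa [piv_nb, nb_apply hp])
      (Or.inr (by rwa [piv_nb])) fun h => absurd h hS
    rwa [piv_nb] at this
  exact ⟨hcol, hgood, fun htS => hgood.of_adj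
    ⟨hadj, Or.inl htS, Or.inr hcol, fun _ h => absurd h hS⟩⟩

lemma hasColouring {I : Finset (Fin n)} (hI : I.card = n - 2) (hφ : ∀ i ∈ I, L.φ i = i)
    (hbody : ∀ i ∈ I, ∀ u ∈ L.body i, ∀ u' ∈ L.body i, (L.H (L.φ i)).Reachable u u')
    (hS : ∀ i ∈ I, ∀ t ∈ L.S, L.Good i t)
    (hv : ∀ i ∈ I, ∃ g ∉ L.S, L.col g = i ∧ (g = L.v ∨ (altGraph L.hn).Adj L.v g) ∧ L.Good i g) :
    HasColouring L.hn L.S L.v := by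
  refine ⟨I, L.col, L.κ, hI, fun i hi => ?_⟩
  obtain ⟨g, hgS, hgcol, hgv, w, hw, hgw⟩ := hv i hi
  refine ⟨g, hgS, hgcol, hgv, fun t ht => ?_⟩
  obtain ⟨w', hw', htw'⟩ := hS i hi t ht
  have := (htw'.trans (hbody i hi w' hw' w hw)).trans hgw.symm
  rwa [hφ i hi] at this

lemma mem_body_of_unique {t : Equiv.Perm (Fin n)} (ht : t ∈ insert L.v L.S)
    (huniq : ∀ t' ∈ insert L.v L.S, t' L.p = t L.p → t' = t) : t ∈ L.body (t L.p) := by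
  refine ⟨L.sign_eq_one t ht, rfl, ?_⟩
  rintro ⟨t', ht', hp, hadj, -⟩
  exact hadj.ne (huniq t' ht' hp)

end Layout

end Layouts

section Split

variable {n : ℕ} {L : Layout n} {a s : Fin n}

/-- The colours are the symbols other than `a` and `s`, and among the other copies at most one
contains a terminal. -/
structure Layout.Split (L : Layout n) (a s : Fin n) : Prop where
  ne : a ≠ s
  act_iff : ∀ c i, L.act c i ↔ (i ≠ a ∧ i ≠ s) ∧ i ≠ c
  φ_eq : ∀ i, i ≠ a ∧ i ≠ s → L.φ i = i
  hub : ∀ t ∈ insert L.v L.S, ∀ t' ∈ insert L.v L.S, t L.p ≠ a ∧ t L.p ≠ s →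
    t' L.p ≠ a ∧ t' L.p ≠ s → t = t'
  κ_eq : ∀ t ∈ L.S, ∀ u ∈ L.S, t L.p ≠ u L.p → u L.p ≠ a ∧ u L.p ≠ s →
    L.κ t u = u L.p ∧ L.κ u t = u L.p

namespace Layout.Split

lemma clear (h : L.Split a s) {t : Equiv.Perm (Fin n)} (ht : t ∈ insert L.v L.S) {i : Fin n}
    (hi : i ≠ a ∧ i ≠ s) (hit : i ≠ t L.p) : L.Clear i (t L.p) := by
  by_cases hsp : t L.p ≠ a ∧ t L.p ≠ s
  · refine Or.inr fun t' ht' e => hit ?_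
    rw [h.hub t ht t' ht' hsp (e ▸ hi), e]
  · exact Or.inl fun hact => hsp ((h.act_iff _ _).1 hact).1

lemma clear_of_special (h : L.Split a s) {c : Fin n} (hc : c = a ∨ c = s) (i : Fin n) :
    L.Clear i c :=
  Or.inl fun hact => by
    have := ((h.act_iff _ _).1 hact).1
    tauto

lemma good_terminal (h : L.Split a s) {t : Equiv.Perm (Fin n)} (ht : t ∈ L.S)
    (hi : L.piv t ≠ a ∧ L.piv t ≠ s) : L.Good (L.piv t) t := by
  have ht' := Set.mem_insert_of_mem L.v ht
  refine good_of_ext (L.sign_eq_one t ht') (h.clear ht' hi (apply_ne_piv t).symm) (Or.inl ht)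
    fun _ hS => ?_
  have := h.κ_eq t ht _ hS (by rw [ext_apply]; exact apply_ne_piv t) (by rwa [ext_apply])
  rwa [ext_apply, ← h.φ_eq _ hi] at this

/-- A vertex of a special copy with special pivot symbol is joined to the copy named by its
colour. -/
lemma good_of_special (h : L.Split a s) {m : Equiv.Perm (Fin n)} (hm : Equiv.Perm.sign m = 1)
    (hmS : m ∉ L.S) {i : Fin n} (hi : i ≠ a ∧ i ≠ s) (hp : m L.p = a ∨ m L.p = s)
    (hpiv : L.piv m = a ∨ L.piv m = s) (hφ : L.φ (m L.p) = i) :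
    L.col m = i ∧ L.Good i m := by
  have hcol : L.col m = i := by
    rw [col, if_neg, hφ]
    rintro ⟨t, -, -, -, hact⟩
    have := ((h.act_iff _ _).1 hact).1
    tauto
  have hip : i ≠ m L.p := by rintro rfl; tauto
  have hipiv : i ≠ L.piv m := by rintro rfl; tauto
  have hqp : nb L.hn m i L.p = m L.p := nb_apply hip
  have hqcol : L.col (nb L.hn m i) = i := by
    rw [col, piv_nb, hqp, hφ, h.φ_eq i hi, ite_self]
  have hgood : L.Good i (nb L.hn m i) := by
    have := good_of_ext (L := L) (u := nb L.hn m i) ((sign_nb L.hn hipiv).trans hm)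
      (by rw [hqp]; exact h.clear_of_special hp _)
      (Or.inr (by rw [hqcol, piv_nb, h.φ_eq i hi])) fun hq hqe => ?_
    · rwa [piv_nb] at this
    · rw [piv_nb, h.φ_eq i hi]
      have := h.κ_eq _ hq _ hqe (by rw [ext_apply]; exact apply_ne_piv _)
        (by rwa [ext_apply, piv_nb])
      rwa [ext_apply, piv_nb] at this
  refine ⟨hcol, hgood.of_adj ⟨adj_nb L.hn hipiv, Or.inr ?_, Or.inr ?_, fun h => absurd h hmS⟩⟩
  · rw [hcol, h.φ_eq i hi]
  · rw [hqcol, h.φ_eq i hi]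

lemma hasColouring (h : L.Split a s)
    (hv1 : ∀ u ∈ L.S, ∀ u' ∈ L.S, (altGraph L.hn).Adj L.v u → (altGraph L.hn).Adj L.v u' → u = u')
    (hv2 : ∀ u ∈ L.S, (altGraph L.hn).Adj L.v u → u L.p ≠ L.v L.p → u L.p = a ∨ u L.p = s)
    (hv3 : ∀ u ∈ L.S, (altGraph L.hn).Adj L.v u → u L.p = L.v L.p → L.φ (L.v L.p) = L.piv u)
    (hSS : ∀ t ∈ L.S, ∀ u ∈ L.S, (altGraph L.hn).Adj t u → t L.p = u L.p →
      L.piv u ≠ a ∧ L.piv u ≠ s → L.Good (L.piv u) t) :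
    HasColouring L.hn L.S L.v := by
  classical
  have hmem : ∀ i, i ∈ Finset.univ \ ({a, s} : Finset (Fin n)) ↔ i ≠ a ∧ i ≠ s := by simp
  have hbody : ∀ t ∈ insert L.v L.S, t L.p ≠ a ∧ t L.p ≠ s → t ∈ L.body (t L.p) :=
    fun t ht hi => mem_body_of_unique ht fun t' ht' e => h.hub t' ht' t ht (e ▸ hi) hi
  have hvT : L.v ∈ insert L.v L.S := Set.mem_insert _ _
  refine Layout.hasColouring (I := Finset.univ \ {a, s}) ?_ (fun i hi => h.φ_eq i ((hmem i).1 hi))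
    (fun i hi u hu u' hu' => ?_) (fun i hi t ht => ?_) fun i hi => ?_ <;> try rw [hmem] at hi
  · rw [Finset.card_sdiff_of_subset (Finset.subset_univ _), Finset.card_pair h.ne, Finset.card_univ,
      Fintype.card_fin]
  · have hcard : (Finset.univ \ ({a, s, i} : Finset (Fin n))).card + 3 ≤ n := by
      have h3 : ({a, s, i} : Finset (Fin n)).card = 3 :=
        Finset.card_eq_three.2 ⟨a, s, i, h.ne, hi.1.symm, hi.2.symm, rfl⟩
      have := Finset.card_sdiff_add_card_eq_card (Finset.subset_univ ({a, s, i} : Finset (Fin n)))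
      rw [h3, Finset.card_univ, Fintype.card_fin] at this
      exact this.le
    refine reachable_of_mem_body (fun t ht t' ht' e e' => h.hub t ht t' ht' (e ▸ hi) (e' ▸ hi))
      hcard (fun j hj hji => ?_) hu hu'
    have := ((h.act_iff _ _).1 hj).1
    simp [this, hji]
  · have htT := Set.mem_insert_of_mem L.v ht
    by_cases h1 : t L.p = i
    · subst h1
      exact good_of_mem_body (hbody t htT hi)
    by_cases h2 : L.piv t = i
    · subst h2
      exact h.good_terminal ht hi
    by_cases hS : nb L.hn t i ∈ L.S
    · have := hSS t ht _ hS (adj_nb L.hn (Ne.symm h2)) (nb_apply (Ne.symm h1)).symm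
        (by rwa [piv_nb])
      rwa [piv_nb] at this
    · exact (good_port htT (Ne.symm h1) (Ne.symm h2) ((h.act_iff _ _).2 ⟨hi, Ne.symm h1⟩)
        (h.clear htT hi (Ne.symm h1)) hS).2.2 ht
  · have hve := L.sign_eq_one L.v hvT
    by_cases h1 : L.v L.p = i
    · have hb := hbody L.v hvT (h1 ▸ hi)
      rw [h1] at hb
      exact ⟨L.v, L.notMem, by rw [col_of_mem_body hb, h.φ_eq i hi], Or.inl rfl,
        good_of_mem_body hb⟩
    by_cases h2 : L.piv L.v = i
    · have hb : L.ext L.v ∈ L.body (L.piv L.v) := ext_mem_body hve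
        (h.clear hvT (h2 ▸ hi) (apply_ne_piv L.v).symm)
      rw [h2] at hb
      refine ⟨L.ext L.v, fun hS => ?_, by rw [col_of_mem_body hb, h.φ_eq i hi],
        Or.inr (adj_ext _), good_of_mem_body hb⟩
      have := hv2 _ hS (adj_ext _) (by rw [ext_apply]; exact (apply_ne_piv _).symm)
      rw [ext_apply, h2] at this
      tauto
    have hadj := adj_nb L.hn (Ne.symm h2)
    have hp : nb L.hn L.v i L.p = L.v L.p := nb_apply (Ne.symm h1)
    by_cases hS : nb L.hn L.v i ∈ L.S
    · have hφ : L.φ (L.v L.p) = i := by rw [hv3 _ hS hadj hp, piv_nb]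
      have hsp : L.v L.p = a ∨ L.v L.p = s := by
        by_contra hno
        rw [not_or] at hno
        rw [h.φ_eq _ hno] at hφ
        exact h1 hφ
      by_cases h3 : L.piv L.v = a ∨ L.piv L.v = s
      · obtain ⟨hcol, hgood⟩ := h.good_of_special hve L.notMem hi hsp h3 hφ
        exact ⟨L.v, L.notMem, hcol, Or.inl rfl, hgood⟩
      · obtain ⟨o, ho, hop⟩ : ∃ o, (o = a ∨ o = s) ∧ o ≠ L.v L.p := by
          rcases hsp with e | e
          · exact ⟨s, Or.inr rfl, e ▸ h.ne.symm⟩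
          · exact ⟨a, Or.inl rfl, e ▸ h.ne⟩
        have hopiv : o ≠ L.piv L.v := fun e => h3 (e ▸ ho)
        have hoadj := adj_nb L.hn hopiv
        have hoS : nb L.hn L.v o ∉ L.S := fun hoS => by
          have := congrArg L.piv (hv1 _ hoS _ hS hoadj hadj)
          rw [piv_nb, piv_nb] at this
          subst this
          tauto
        have hgp : nb L.hn L.v o L.p = L.v L.p := nb_apply hop
        obtain ⟨hcol, hgood⟩ := h.good_of_special ((sign_nb L.hn hopiv).trans hve) hoS hi
          (hgp ▸ hsp) (by rwa [piv_nb]) (by rw [hgp, hφ])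
        exact ⟨_, hoS, hcol, Or.inr hoadj, hgood⟩
    · obtain ⟨hcol, hgood, -⟩ := good_port hvT (Ne.symm h1) (Ne.symm h2)
        ((h.act_iff _ _).2 ⟨hi, Ne.symm h1⟩) (h.clear hvT hi (Ne.symm h1)) hS
      exact ⟨_, hS, by rw [hcol, h.φ_eq i hi], Or.inr hadj, hgood⟩

end Layout.Split

end Split

section Configurations

variable {n : ℕ}

/-- Three even permutations, and an even permutation `v` that is adjacent to at most one of them. -/
structure Config (hn : 3 ≤ n) (x y z v : Equiv.Perm (Fin n)) : Prop where
  sign_eq_one : ∀ t ∈ (insert v {x, y, z} : Set (Equiv.Perm (Fin n))), Equiv.Perm.sign t = 1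
  xy : x ≠ y
  xz : x ≠ z
  yz : y ≠ z
  notMem : v ∉ ({x, y, z} : Set (Equiv.Perm (Fin n)))
  unique : ∀ u ∈ ({x, y, z} : Set (Equiv.Perm (Fin n))),
    ∀ u' ∈ ({x, y, z} : Set (Equiv.Perm (Fin n))),
      (altGraph hn).Adj v u → (altGraph hn).Adj v u' → u = u'

namespace Config

variable {hn : 3 ≤ n} {x y z v : Equiv.Perm (Fin n)}

lemma swap (C : Config hn x y z v) : Config hn y x z v where
  sign_eq_one := by rw [Set.insert_comm y]; exact C.sign_eq_one
  xy := C.xy.symm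
  xz := C.yz
  yz := C.xz
  notMem := by rw [Set.insert_comm y]; exact C.notMem
  unique := by rw [Set.insert_comm y]; exact C.unique

lemma swap' (C : Config hn x y z v) : Config hn x z y v where
  sign_eq_one := by rw [Set.pair_comm z]; exact C.sign_eq_one
  xy := C.xz
  xz := C.xy
  yz := C.yz.symm
  notMem := by rw [Set.pair_comm z]; exact C.notMem
  unique := by rw [Set.pair_comm z]; exact C.unique

/-- The layout with special copies `a` and `s`, in which these are coloured `i` and `j`. -/
def splitLayout (C : Config hn x y z v) {p : Fin n} (hp : 3 ≤ (p : ℕ)) (a s i j : Fin n)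
    (κ : Equiv.Perm (Fin n) → Equiv.Perm (Fin n) → Fin n) : Layout n where
  hn := hn
  p := p
  three_le := hp
  S := {x, y, z}
  v := v
  sign_eq_one := C.sign_eq_one
  notMem := C.notMem
  act c i := (i ≠ a ∧ i ≠ s) ∧ i ≠ c
  φ c := if c = a then i else if c = s then j else c
  κ := κ

/-- `x`, `y`, `z` are pairwise adjacent. -/
lemma hasColouring_of_agree (C : Config hn x y z v) (h4 : 4 ≤ n)
    (hxy : ∀ q : Fin n, 3 ≤ (q : ℕ) → x q = y q) (hxz : ∀ q : Fin n, 3 ≤ (q : ℕ) → x q = z q)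
    (hvy : ¬ (altGraph hn).Adj v y) (hvz : ¬ (altGraph hn).Adj v z) :
    HasColouring hn {x, y, z} v := by
  classical
  let p : Fin n := ⟨3, h4⟩
  have hp : 3 ≤ (p : ℕ) := le_rfl
  let L := C.splitLayout hp (x p) (z (pivot hn)) (x (pivot hn)) (x (pivot hn))
    fun t u => if t = z ∨ u = z then y (pivot hn) else x (pivot hn)
  have hS : ∀ t ∈ L.S, t p = x p := by
    rintro t (rfl | rfl | rfl)
    exacts [rfl, (hxy p hp).symm, (hxz p hp).symm]
  have hxs : Equiv.Perm.sign x = 1 := C.sign_eq_one x (by simp)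
  have hys : Equiv.Perm.sign y = 1 := C.sign_eq_one y (by simp)
  have hzs : Equiv.Perm.sign z = 1 := C.sign_eq_one z (by simp)
  have hx : x ∈ L.S := by simp [L, splitLayout]
  have hy : y ∈ L.S := by simp [L, splitLayout]
  have hz : z ∈ L.S := by simp [L, splitLayout]
  have hvu : ∀ u ∈ L.S, (altGraph hn).Adj v u → u = x := by
    rintro u (rfl | rfl | rfl) h
    exacts [rfl, absurd h hvy, absurd h hvz]
  have hL : L.Split (x p) (z (pivot hn)) :=
    { ne := by rw [hxz p hp]; exact L.apply_ne_piv z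
      act_iff := fun c i => Iff.rfl
      φ_eq := fun i hi => by simp [L, splitLayout, hi]
      hub := by
        rintro t (rfl | ht) t' (rfl | ht') h h'
        · rfl
        · exact absurd (hS t' ht') h'.1
        · exact absurd (hS t ht) h.1
        · exact absurd (hS t ht) h.1
      κ_eq := fun t ht u hu h => absurd ((hS t ht).trans (hS u hu).symm) h }
  have hκ : ∀ t u, L.κ t u = if t = z ∨ u = z then y (pivot hn) else x (pivot hn) := fun _ _ => rfl
  have hφ : L.φ (x p) = x (pivot hn) ∧ L.φ (z (pivot hn)) = x (pivot hn) := by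
    simp [L, splitLayout]
  refine hL.hasColouring (fun u hu u' hu' h h' => (hvu u hu h).trans (hvu u' hu' h').symm)
    (fun u hu h hne => Or.inl (hS u hu)) (fun u hu h he => ?_) fun t ht u hu htu he hi => ?_
  · obtain rfl := hvu u hu h
    rw [← he]
    exact hφ.1
  have hadj : ∀ t u, Equiv.Perm.sign t = 1 → Equiv.Perm.sign u = 1 → t ≠ u →
      (∀ q : Fin n, 3 ≤ (q : ℕ) → t q = u q) → t ∈ L.S → u ∈ L.S → ∀ i, L.φ i = i →
      L.κ t u = i → L.κ u t = i → (L.H (L.φ i)).Adj t u :=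
    fun t u h1 h2 hne h3 ht hu i hφi h4 h5 => ⟨adj_of_agree hn (h1.trans h2.symm) hne h3, Or.inl ht,
      Or.inl hu, fun _ _ => by rw [hφi]; exact ⟨h4, h5⟩⟩
  have hgood := hL.good_terminal hu hi
  have hφi := hL.φ_eq _ hi
  rcases hu with rfl | rfl | rfl
  · rcases ht with rfl | rfl | rfl
    · exact absurd rfl htu.ne
    · exact hgood.of_adj (hadj _ _ hys hxs C.xy.symm (fun q hq => (hxy q hq).symm) hy hx _ hφi
        (by rw [hκ, if_neg (by simp [C.yz, C.xz])]; rfl)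
        (by rw [hκ, if_neg (by simp [C.yz, C.xz])]; rfl))
    · have hpS : L.ext t L.p ≠ u p := by rw [Layout.ext_apply]; exact hL.ne.symm
      have hm : L.ext t ∉ L.S := fun h => hpS (hS _ h)
      obtain ⟨hcol, hg⟩ := hL.good_of_special (m := L.ext t)
        ((sign_nb hn (L.apply_ne_piv t)).trans hzs) hm hi (Or.inr (Layout.ext_apply _))
        (Or.inl ((Layout.piv_ext t).trans he)) (by rw [Layout.ext_apply]; exact hφ.2)
      exact hg.of_adj ⟨Layout.adj_ext t, Or.inl hz, Or.inr (hcol.trans hφi.symm), fun _ h => absurd h hm⟩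
  · have hzy := hgood.of_adj (hadj _ _ hzs hys C.yz.symm
        (fun q hq => (hxz q hq).symm.trans (hxy q hq)) hz hy _ hφi
        (by rw [hκ, if_pos (Or.inl rfl)]; rfl) (by rw [hκ, if_pos (Or.inr rfl)]; rfl))
    rcases ht with rfl | rfl | rfl
    · exact hzy.of_adj (hadj _ _ hxs hzs C.xz hxz hx hz _ hφi
        (by rw [hκ, if_pos (Or.inr rfl)]; rfl) (by rw [hκ, if_pos (Or.inl rfl)]; rfl))
    · exact absurd rfl htu.ne
    · exact hzy
  · exact absurd rfl hi.2

/-- `x` and `y` lie in one copy and `z` in another. -/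
lemma hasColouring_of_two_copies (C : Config hn x y z v) {p : Fin n} (hp : 3 ≤ (p : ℕ))
    (hxy : x p = y p) (hxz : x p ≠ z p) (hvx : ¬ (altGraph hn).Adj v x) :
    HasColouring hn {x, y, z} v := by
  classical
  let k := if x (pivot hn) ≠ x p ∧ x (pivot hn) ≠ z p then x (pivot hn) else y (pivot hn)
  let L := C.splitLayout hp (x p) (z p) (y (pivot hn)) (z (pivot hn)) fun _ _ => k
  have hx : x ∈ L.S := by simp [L, splitLayout]
  have hy : y ∈ L.S := by simp [L, splitLayout]
  have hS : ∀ t ∈ L.S, t p = x p ∨ t p = z p := by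
    rintro t (rfl | rfl | rfl)
    exacts [Or.inl rfl, Or.inl hxy.symm, Or.inr rfl]
  have hφa : L.φ (x p) = y (pivot hn) := by simp [L, splitLayout]
  have hφs : L.φ (z p) = z (pivot hn) := by simp [L, splitLayout, hxz.symm]
  have hL : L.Split (x p) (z p) :=
    { ne := hxz
      act_iff := fun c i => Iff.rfl
      φ_eq := fun i hi => by simp [L, splitLayout, hi]
      hub := by
        rintro t (rfl | ht) t' (rfl | ht') h h'
        · rfl
        · exact absurd (hS t' ht') (by tauto)
        · exact absurd (hS t ht) (by tauto)
        · exact absurd (hS t ht) (by tauto)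
      κ_eq := fun t ht u hu _ h => absurd (hS u hu) (by tauto) }
  refine hL.hasColouring C.unique (fun u hu _ _ => hS u hu) (fun u hu h he => ?_)
    fun t ht u hu htu he hi => ?_
  · change u p = v p at he
    change L.φ (v p) = u (pivot hn)
    rw [← he]
    rcases hu with rfl | rfl | rfl
    · exact absurd h hvx
    · rw [← hxy, hφa]
    · exact hφs
  have hgood := hL.good_terminal hu hi
  have hφi := hL.φ_eq _ hi
  change t p = u p at he
  rcases ht with rfl | rfl | rfl <;> rcases hu with rfl | rfl | rfl
  · exact absurd rfl htu.ne
  · by_cases hk : t (pivot hn) ≠ t p ∧ t (pivot hn) ≠ z p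
    · have hadj : (altGraph hn).Adj t (nb hn t (z p)) := adj_nb hn hk.2.symm
      have hmp : nb hn t (z p) p = t p := nb_apply_of_ne hn hp hxz
      have hm : nb hn t (z p) ∉ L.S := by
        rintro (h | h | h)
        · exact hadj.ne h.symm
        · refine hi.2 ?_
          rw [← h]
          exact nb_pivot _ _ _
        · exact hxz (by rw [← hmp, h])
      obtain ⟨hcol, hg⟩ := hL.good_of_special ((sign_nb hn hk.2.symm).trans
        (C.sign_eq_one t (by simp))) hm hi (Or.inl hmp) (Or.inr (nb_pivot _ _ _))
        (by change L.φ (nb hn t (z p) p) = _; rw [hmp]; exact hφa)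
      exact hg.of_adj ⟨hadj, Or.inl hx, Or.inr (hcol.trans hφi.symm), fun _ h => absurd h hm⟩
    · have hku : k = L.piv u := if_neg hk
      exact hgood.of_adj ⟨htu, Or.inl hx, Or.inl hy, fun _ _ => by rw [hφi]; exact ⟨hku, hku⟩⟩
  · exact absurd he hxz
  · have hku : k = L.piv u := if_pos hi
    exact hgood.of_adj ⟨htu, Or.inl hy, Or.inl hx, fun _ _ => by rw [hφi]; exact ⟨hku, hku⟩⟩
  · exact absurd rfl htu.ne
  · exact absurd (hxy.trans he) hxz
  · exact absurd he.symm hxz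
  · exact absurd (he.trans hxy.symm).symm hxz
  · exact absurd rfl htu.ne

/-- `x`, `y`, `z` lie in three different copies and `v` lies in the copy of `x`. -/
lemma hasColouring_of_three_copies (C : Config hn x y z v) {p : Fin n} (hp : 3 ≤ (p : ℕ))
    (hxy : x p ≠ y p) (hxz : x p ≠ z p) (hyz : y p ≠ z p) (hvx : v p = x p)
    (hvy : ¬ (altGraph hn).Adj v y) : HasColouring hn {x, y, z} v := by
  let L := C.splitLayout hp (x p) (z p) (x (pivot hn)) (z (pivot hn)) fun _ _ => y p
  have hφa : L.φ (x p) = x (pivot hn) := by simp [L, splitLayout]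
  have hT : ∀ t ∈ insert L.v L.S, t p ≠ x p ∧ t p ≠ z p → t = y := by
    rintro t (rfl | rfl | rfl | rfl) h
    · exact absurd hvx h.1
    · exact absurd rfl h.1
    · rfl
    · exact absurd rfl h.2
  have hL : L.Split (x p) (z p) :=
    { ne := hxz
      act_iff := fun c i => Iff.rfl
      φ_eq := fun i hi => by simp [L, splitLayout, hi]
      hub := fun t ht t' ht' h h' => (hT t ht h).trans (hT t' ht' h').symm
      κ_eq := fun t ht u hu _ h => by
        obtain rfl := hT u (Set.mem_insert_of_mem _ hu) h
        exact ⟨rfl, rfl⟩ }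
  refine hL.hasColouring C.unique (fun u hu h hne => ?_) (fun u hu h he => ?_)
    fun t ht u hu htu he hi => ?_
  · by_contra hno
    rw [not_or] at hno
    obtain rfl := hT u (Set.mem_insert_of_mem _ hu) hno
    exact hvy h
  · change u p = v p at he
    change L.φ (v p) = u (pivot hn)
    rw [hvx]
    rw [hvx] at he
    rcases hu with rfl | rfl | rfl
    · exact hφa
    · exact absurd he.symm hxy
    · exact absurd he.symm hxz
  · change t p = u p at he
    rcases ht with rfl | rfl | rfl <;> rcases hu with rfl | rfl | rfl <;>
      first
        | exact absurd rfl htu.ne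
        | exact absurd he ‹_›
        | exact absurd he.symm ‹_›

end Config

end Configurations

section Separated

variable {n : ℕ}

namespace Layout

variable {L : Layout n}

/-- Distinct terminals lie in distinct copies. -/
def Separated (L : Layout n) : Prop :=
  Set.InjOn (fun t : Equiv.Perm (Fin n) => t L.p) (insert L.v L.S)

namespace Separated

lemma mem_body (h : L.Separated) {t : Equiv.Perm (Fin n)} (ht : t ∈ insert L.v L.S) :
    t ∈ L.body (t L.p) :=
  mem_body_of_unique ht fun _ ht' e => h ht' ht e

lemma nb_notMem (h : L.Separated) {t : Equiv.Perm (Fin n)} (ht : t ∈ insert L.v L.S) {i : Fin n}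
    (hp : i ≠ t L.p) (hpiv : i ≠ L.piv t) : nb L.hn t i ∉ L.S := fun hS =>
  (adj_nb L.hn hpiv).ne (h ht (Set.mem_insert_of_mem _ hS) (nb_apply hp).symm)

lemma good_terminal (h : L.Separated) {t : Equiv.Perm (Fin n)} (ht : t ∈ L.S) {i : Fin n}
    (hp : i ≠ t L.p) (hact : L.act (t L.p) i) (hc : L.Clear i (t L.p))
    (hκ : ∀ u ∈ L.S, u L.p = i → L.κ t u = L.φ i ∧ L.κ u t = L.φ i) : L.Good i t := by
  have ht' := Set.mem_insert_of_mem L.v ht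
  by_cases hpiv : L.piv t = i
  · subst hpiv
    exact good_of_ext (L.sign_eq_one t ht') hc (Or.inl ht) fun _ hS => hκ _ hS (ext_apply t)
  · exact (good_port ht' hp (Ne.symm hpiv) hact hc (h.nb_notMem ht' hp (Ne.symm hpiv))).2.2 ht

lemma exists_good (h : L.Separated) {i : Fin n} (hp : i ≠ L.v L.p) (hact : L.act (L.v L.p) i)
    (hc : L.Clear i (L.v L.p)) (hv : ∀ u ∈ L.S, u L.p = i → ¬ (altGraph L.hn).Adj L.v u) :
    ∃ g ∉ L.S, L.col g = L.φ i ∧ (g = L.v ∨ (altGraph L.hn).Adj L.v g) ∧ L.Good i g := by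
  have ht := Set.mem_insert L.v L.S
  by_cases hpiv : L.piv L.v = i
  · subst hpiv
    have hb := ext_mem_body (L.sign_eq_one _ ht) hc
    exact ⟨L.ext L.v, fun hS => hv _ hS (ext_apply _) (adj_ext _), Layout.col_of_mem_body hb,
      Or.inr (adj_ext _), Layout.good_of_mem_body hb⟩
  · have hS := h.nb_notMem ht hp (Ne.symm hpiv)
    obtain ⟨hcol, hg, -⟩ := good_port ht hp (Ne.symm hpiv) hact hc hS
    exact ⟨_, hS, hcol, Or.inr (adj_nb L.hn (Ne.symm hpiv)), hg⟩

/-- The bodies of the copy of `t` and of copy `i` are joined if they have the same colour. -/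
lemma good_link (h : L.Separated) {t : Equiv.Perm (Fin n)} (ht : t ∈ L.S) {i : Fin n}
    (hp : i ≠ t L.p) (hact : ¬ L.act (t L.p) i) (hc : L.Clear i (t L.p))
    (hφ : L.φ i = L.φ (t L.p))
    (hκ : ∀ u ∈ L.S, u L.p = i → L.κ t u = L.φ i ∧ L.κ u t = L.φ i)
    (hbody : ∀ c, ∀ u ∈ L.body c, ∀ u' ∈ L.body c, (L.H (L.φ c)).Reachable u u')
    {u : Equiv.Perm (Fin n)} (hu : L.Good i u) : L.Good (t L.p) u := by
  have ht' := Set.mem_insert_of_mem L.v ht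
  have hts := L.sign_eq_one t ht'
  have htb := h.mem_body ht'
  have htg : L.Good i t := by
    by_cases hpiv : L.piv t = i
    · subst hpiv
      exact good_of_ext hts hc (Or.inl ht) fun _ hS => hκ _ hS (ext_apply t)
    · have hm := nb_apply (L := L) hp
      have hS := h.nb_notMem ht' hp (Ne.symm hpiv)
      have hms := (sign_nb L.hn (Ne.symm hpiv)).trans hts
      have hb : nb L.hn t i ∈ L.body (t L.p) := by
        refine ⟨hms, hm, ?_⟩
        rintro ⟨_, -, -, -, ha⟩
        rw [hm, piv_nb] at ha
        exact hact ha
      have hg := good_of_ext (L := L) hms (by rwa [piv_nb, hm])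
        (Or.inr (by rw [Layout.col_of_mem_body hb, piv_nb, hφ])) fun h' => absurd h' hS
      rw [piv_nb] at hg
      obtain ⟨w, hw, hr⟩ := hg
      exact ⟨w, hw, (hφ ▸ hbody _ _ htb _ hb).trans hr⟩
  obtain ⟨w, hw, hr⟩ := htg
  obtain ⟨w', hw', hr'⟩ := hu
  refine ⟨t, htb, ?_⟩
  rw [← hφ]
  exact (hr'.trans (hbody i w' hw' w hw)).trans hr.symm

end Separated

end Layout

/-- The four vertices lie in different copies. -/
lemma Config.hasColouring_of_four_copies {hn : 3 ≤ n} {x y z v : Equiv.Perm (Fin n)}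
    (C : Config hn x y z v) {p : Fin n} (hp : 3 ≤ (p : ℕ)) (hxy : x p ≠ y p) (hxz : x p ≠ z p)
    (hyz : y p ≠ z p) (hvx : v p ≠ x p) (hvy : v p ≠ y p) (hvz : v p ≠ z p)
    (hadj : ¬ (altGraph hn).Adj v y) : HasColouring hn {x, y, z} v := by
  classical
  set X := x p with hX
  set Y := y p with hY
  set Z := z p with hZ
  set W := v p with hW
  let L : Layout n :=
    { hn := hn
      p := p
      three_le := hp
      S := {x, y, z}
      v := v
      sign_eq_one := C.sign_eq_one
      notMem := C.notMem
      act := fun c i => (i ≠ X ∧ i ≠ Y ∧ i ≠ Z ∧ i ≠ W) ∨ (c = X ∧ i = W) ∨ (c = Y ∧ i = Z) ∨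
        (c = Z ∧ i = X) ∨ (c = W ∧ i = Y)
      φ := fun c => if c = Y then X else if c = W then Z else c
      κ := fun t u => if t = y ∧ u = z ∨ t = z ∧ u = y then Z else X }
  have hact : ∀ c i, L.act c i ↔ (i ≠ X ∧ i ≠ Y ∧ i ≠ Z ∧ i ≠ W) ∨ (c = X ∧ i = W) ∨
      (c = Y ∧ i = Z) ∨ (c = Z ∧ i = X) ∨ (c = W ∧ i = Y) := fun _ _ => Iff.rfl
  have hφX : L.φ X = X := by simp [L, hxy, hvx.symm]
  have hφY : L.φ Y = X := by simp [L]
  have hφZ : L.φ Z = Z := by simp [L, hyz.symm, hvz.symm]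
  have hφW : L.φ W = Z := by simp [L, hvy]
  have hφ : ∀ i, i ≠ Y → i ≠ W → L.φ i = i := fun i h1 h2 => by simp [L, h1, h2]
  have hx : x ∈ L.S := by simp [L]
  have hy : y ∈ L.S := by simp [L]
  have hz : z ∈ L.S := by simp [L]
  have hsep : L.Separated := by
    rintro t (rfl | rfl | rfl | rfl) t' (rfl | rfl | rfl | rfl) (e : _ = _) <;>
      first
        | rfl
        | exact absurd e ‹_›
        | exact absurd e.symm ‹_›
  have hS : ∀ t ∈ L.S, t p = X ∧ t = x ∨ t p = Y ∧ t = y ∨ t p = Z ∧ t = z := by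
    rintro t (rfl | rfl | rfl)
    exacts [Or.inl ⟨rfl, rfl⟩, Or.inr (Or.inl ⟨rfl, rfl⟩), Or.inr (Or.inr ⟨rfl, rfl⟩)]
  have hT : ∀ t ∈ insert L.v L.S, t p = X ∨ t p = Y ∨ t p = Z ∨ t p = W := by
    rintro t (rfl | rfl | rfl | rfl) <;> simp [hX, hY, hZ, hW]
  have hbody : ∀ c, ∀ u ∈ L.body c, ∀ u' ∈ L.body c, (L.H (L.φ c)).Reachable u u' := by
    intro c u hu u' hu'
    obtain ⟨A, hA, hAc⟩ : ∃ A : Finset (Fin n), A.card + 3 ≤ n ∧ ∀ i, L.act c i → i ≠ c → i ∈ A := by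
      have key : ∀ a b d : Fin n, a ≠ b → a ≠ d → b ≠ d →
          (Finset.univ \ ({a, b, d} : Finset (Fin n))).card + 3 ≤ n := fun a b d h1 h2 h3 => by
        have := Finset.card_sdiff_add_card_eq_card (Finset.subset_univ ({a, b, d} : Finset (Fin n)))
        rw [Finset.card_eq_three.2 ⟨a, b, d, h1, h2, h3, rfl⟩, Finset.card_univ,
          Fintype.card_fin] at this
        exact this.le
      by_cases h1 : c = Y
      · refine ⟨_, key X Y W hxy hvx.symm hvy.symm, fun i hi _ => ?_⟩
        simp only [hact, h1] at hi
        simp only [Finset.mem_sdiff, Finset.mem_univ, Finset.mem_insert, Finset.mem_singleton]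
        grind
      by_cases h2 : c = Z
      · refine ⟨_, key Y Z W hyz hvy.symm hvz.symm, fun i hi _ => ?_⟩
        simp only [hact, h2] at hi
        simp only [Finset.mem_sdiff, Finset.mem_univ, Finset.mem_insert, Finset.mem_singleton]
        grind
      by_cases h3 : c = W
      · refine ⟨_, key X Z W hxz hvx.symm hvz.symm, fun i hi _ => ?_⟩
        simp only [hact, h3] at hi
        simp only [Finset.mem_sdiff, Finset.mem_univ, Finset.mem_insert, Finset.mem_singleton]
        grind
      · refine ⟨_, key X Y Z hxy hxz hyz, fun i hi _ => ?_⟩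
        rw [hact] at hi
        simp only [Finset.mem_sdiff, Finset.mem_univ, Finset.mem_insert, Finset.mem_singleton]
        grind
    exact Layout.reachable_of_mem_body (fun t ht t' ht' e e' => hsep ht ht' (e.trans e'.symm)) hA hAc hu hu'
  have hκ : ∀ t u, L.κ t u = if t = y ∧ u = z ∨ t = z ∧ u = y then Z else X := fun _ _ => rfl
  have hκx : ∀ t ∈ L.S, L.κ x t = X ∧ L.κ t x = X := fun t _ => by
    simp [hκ, C.xy, C.xz]
  have hκyz : L.κ y z = Z ∧ L.κ z y = Z := by simp [hκ]
  have hpx : ∀ t ∈ L.S, t p = X → t = x := fun t ht e => by grind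
  have hpy : ∀ t ∈ L.S, t p = Y → t = y := fun t ht e => by grind
  have hpz : ∀ t ∈ L.S, t p = Z → t = z := fun t ht e => by grind
  have hpw : ∀ t ∈ L.S, t p ≠ W := fun t ht e => by grind
  have hYX : ∀ u, L.Good Y u → L.Good X u := fun u hu =>
    hsep.good_link hx hxy.symm (by rw [hact]; grind) (Or.inl (by rw [hact]; grind))
      (hφY.trans hφX.symm) (fun t ht _ => hφY ▸ hκx t ht) hbody hu
  have hWZ : ∀ u, L.Good W u → L.Good Z u := fun u hu =>
    hsep.good_link hz hvz (by rw [hact]; grind) (Or.inl (by rw [hact]; grind))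
      (hφW.trans hφZ.symm) (fun t ht e => absurd e (hpw t ht)) hbody hu
  have hbx : L.Good X x := Layout.good_of_mem_body (hsep.mem_body (Set.mem_insert_of_mem _ hx))
  have hby : L.Good Y y := Layout.good_of_mem_body (hsep.mem_body (Set.mem_insert_of_mem _ hy))
  have hbz : L.Good Z z := Layout.good_of_mem_body (hsep.mem_body (Set.mem_insert_of_mem _ hz))
  have hbv : v ∈ L.body W := hsep.mem_body (Set.mem_insert _ _)
  have hmem : ∀ i, i ∈ Finset.univ \ ({Y, W} : Finset (Fin n)) ↔ i ≠ Y ∧ i ≠ W := by simp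
  refine L.hasColouring (I := Finset.univ \ {Y, W}) ?_
    (fun i hi => hφ i ((hmem i).1 hi).1 ((hmem i).1 hi).2) (fun i _ => hbody i)
    (fun i hi t ht => ?_) fun i hi => ?_
  · rw [Finset.card_sdiff_of_subset (Finset.subset_univ _), Finset.card_pair hvy.symm,
      Finset.card_univ, Fintype.card_fin]
  · rw [hmem] at hi
    by_cases hiX : i = X
    · subst hiX
      rcases ht with rfl | rfl | rfl
      · exact hbx
      · exact hYX _ hby
      · exact hsep.good_terminal hz hxz (by rw [hact]; grind) (Or.inl (by rw [hact]; grind))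
          fun u hu e => by rw [hpx u hu e, hφX]; exact (hκx _ hz).symm
    by_cases hiZ : i = Z
    · subst hiZ
      rcases ht with rfl | rfl | rfl
      · exact hWZ _ (hsep.good_terminal hx hvx (by rw [hact]; grind) (Or.inl (by rw [hact]; grind))
          fun u hu e => absurd e (hpw u hu))
      · exact hsep.good_terminal hy hyz.symm (by rw [hact]; grind) (Or.inl (by rw [hact]; grind))
          fun u hu e => by rw [hpz u hu e, hφZ]; exact hκyz
      · exact hbz
    · have hclear : ∀ t ∈ insert L.v L.S, t L.p ≠ i := fun t ht e => by
        have := hT t ht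
        change t p = i at e
        grind
      have htT := Set.mem_insert_of_mem L.v ht
      exact hsep.good_terminal ht (hclear t htT).symm (Or.inl ⟨hiX, hi.1, hiZ, hi.2⟩)
        (Or.inr hclear) fun u hu e => absurd e (hclear u (Set.mem_insert_of_mem L.v hu))
  · rw [hmem] at hi
    by_cases hiX : i = X
    · subst hiX
      obtain ⟨g, hgS, hg1, hg2, hg3⟩ := hsep.exists_good (i := Y) hvy.symm (by rw [hact]; grind)
        (Or.inl (by rw [hact]; grind)) fun u hu e => by rw [hpy u hu e]; exact hadj
      exact ⟨g, hgS, hg1.trans hφY, hg2, hYX _ hg3⟩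
    by_cases hiZ : i = Z
    · subst hiZ
      exact ⟨v, C.notMem, (Layout.col_of_mem_body hbv).trans hφW, Or.inl rfl, hWZ _ (Layout.good_of_mem_body hbv)⟩
    · have hclear : ∀ t ∈ insert L.v L.S, t L.p ≠ i := fun t ht e => by
        have := hT t ht
        change t p = i at e
        grind
      obtain ⟨g, hgS, hg1, hg2, hg3⟩ := hsep.exists_good (i := i)
        (hclear _ (Set.mem_insert _ _)).symm (Or.inl ⟨hiX, hi.1, hiZ, hi.2⟩) (Or.inr hclear)
        fun u hu e => absurd e (hclear u (Set.mem_insert_of_mem L.v hu))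
      exact ⟨g, hgS, hg1.trans (hφ i hi.1 hi.2), hg2, hg3⟩

end Separated

namespace Config

variable {n : ℕ} {hn : 3 ≤ n} {x y z v : Equiv.Perm (Fin n)}

lemma not_adj_of_adj (C : Config hn x y z v) (h : (altGraph hn).Adj v x) :
    ¬ (altGraph hn).Adj v y := fun h' => C.xy (C.unique x (by simp) y (by simp) h h')

lemma hasColouring (C : Config hn x y z v) (h4 : 4 ≤ n) : HasColouring hn {x, y, z} v := by
  have two : ∀ {x y z : Equiv.Perm (Fin n)}, Config hn x y z v → ∀ p : Fin n, 3 ≤ (p : ℕ) →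
      x p = y p → x p ≠ z p → HasColouring hn {x, y, z} v := by
    intro x y z C p hp hxy hxz
    by_cases h : (altGraph hn).Adj v x
    · rw [Set.insert_comm]
      exact C.swap.hasColouring_of_two_copies hp hxy.symm (hxy ▸ hxz) (C.not_adj_of_adj h)
    · exact C.hasColouring_of_two_copies hp hxy hxz h
  have three : ∀ {x y z : Equiv.Perm (Fin n)}, Config hn x y z v → ∀ p : Fin n, 3 ≤ (p : ℕ) →
      x p ≠ y p → x p ≠ z p → y p ≠ z p → v p = x p → HasColouring hn {x, y, z} v := by
    intro x y z C p hp hxy hxz hyz hvx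
    by_cases h : (altGraph hn).Adj v y
    · rw [Set.pair_comm]
      exact C.swap'.hasColouring_of_three_copies hp hxz hxy hyz.symm hvx
        (C.swap.swap'.not_adj_of_adj h)
    · exact C.hasColouring_of_three_copies hp hxy hxz hyz hvx h
  have e1 : ({x, y, z} : Set (Equiv.Perm (Fin n))) = {y, x, z} := Set.insert_comm _ _ _
  have e2 : ({x, y, z} : Set (Equiv.Perm (Fin n))) = {x, z, y} := by rw [Set.pair_comm]
  have e3 : ({x, y, z} : Set (Equiv.Perm (Fin n))) = {y, z, x} := by rw [e1, Set.pair_comm]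
  have e4 : ({x, y, z} : Set (Equiv.Perm (Fin n))) = {z, x, y} := by rw [e2, Set.insert_comm]
  by_cases hall : ∀ p : Fin n, 3 ≤ (p : ℕ) → x p = y p ∧ x p = z p
  · by_cases hy : (altGraph hn).Adj v y
    · rw [e1]
      exact C.swap.hasColouring_of_agree h4 (fun q hq => (hall q hq).1.symm)
        (fun q hq => (hall q hq).1.symm.trans (hall q hq).2) (C.swap.not_adj_of_adj hy)
        (C.swap.swap'.not_adj_of_adj hy)
    by_cases hz : (altGraph hn).Adj v z
    · rw [e4]
      exact C.swap'.swap.hasColouring_of_agree h4 (fun q hq => (hall q hq).2.symm)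
        (fun q hq => (hall q hq).2.symm.trans (hall q hq).1) (C.swap'.swap.not_adj_of_adj hz) hy
    · exact C.hasColouring_of_agree h4 (fun q hq => (hall q hq).1) (fun q hq => (hall q hq).2) hy hz
  push Not at hall
  obtain ⟨p, hp, hne⟩ := hall
  by_cases hxy : x p = y p
  · exact two C p hp hxy (hne hxy)
  by_cases hxz : x p = z p
  · rw [e2]
    exact two C.swap' p hp hxz hxy
  by_cases hyz : y p = z p
  · rw [e3]
    exact two C.swap.swap' p hp hyz (Ne.symm hxy)
  by_cases hvx : v p = x p
  · exact three C p hp hxy hxz hyz hvx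
  by_cases hvy : v p = y p
  · rw [e1]
    exact three C.swap p hp (Ne.symm hxy) hyz hxz hvy
  by_cases hvz : v p = z p
  · rw [e4]
    exact three C.swap'.swap p hp (Ne.symm hxz) (Ne.symm hyz) hxy hvz
  by_cases h : (altGraph hn).Adj v y
  · rw [e1]
    exact C.swap.hasColouring_of_four_copies hp (Ne.symm hxy) hyz hxz hvy hvx hvz
      (C.swap.not_adj_of_adj h)
  · exact C.hasColouring_of_four_copies hp hxy hxz hyz hvx hvy hvz h

end Config

/-- Let n ≥ 4 and let S = {x, y, z, w} be four distinct vertices of EA_n with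
x, y, z even, w odd, w∘(12) ∉ {x, y, z}, and w∘(12) adjacent to at most one of
x, y, z. Then there exist n − 1 pairwise internally edge disjoint S-trees. -/
theorem IDSTs_three_even_one_odd (n : ℕ) (hn : 4 ≤ n) (x y z w : Equiv.Perm (Fin n))
    (hxy : x ≠ y) (hxz : x ≠ z) (hxw : x ≠ w) (hyz : y ≠ z) (hyw : y ≠ w)
    (hzw : z ≠ w)
    (hsx : Equiv.Perm.sign x = 1) (hsy : Equiv.Perm.sign y = 1)
    (hsz : Equiv.Perm.sign z = 1) (hsw : Equiv.Perm.sign w = -1)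
    (htilde : w * perm12 n (by omega) ∉ ({x, y, z} : Set (Equiv.Perm (Fin n))))
    (hadj : Set.ncard {u : Equiv.Perm (Fin n) |
        u ∈ ({x, y, z} : Set (Equiv.Perm (Fin n))) ∧
        (godanGraph n (by omega)).Adj (w * perm12 n (by omega)) u} ≤ 1) :
    ∃ T : Fin (n - 1) → (godanGraph n (by omega)).Subgraph,
      IsIDSTFamily (godanGraph n (by omega))
        ({x, y, z, w} : Set (Equiv.Perm (Fin n))) T := by
  have hn3 : 3 ≤ n := by omega
  have hv : Equiv.Perm.sign (w * perm12 n hn3) = 1 := by rw [sign_mul_perm12, hsw, neg_neg]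
  have hS : ∀ t ∈ ({x, y, z} : Set (Equiv.Perm (Fin n))), Equiv.Perm.sign t = 1 := by
    rintro t (rfl | rfl | rfl)
    exacts [hsx, hsy, hsz]
  have C : Config hn3 x y z (w * perm12 n hn3) :=
    { sign_eq_one := by
        rintro t (rfl | ht)
        exacts [hv, hS t ht]
      xy := hxy
      xz := hxz
      yz := hyz
      notMem := htilde
      unique := fun u hu u' hu' h h' =>
        (Set.ncard_le_one (Set.toFinite _)).1 hadj u ⟨hu, altGraph_le hn3 h⟩ u'
          ⟨hu', altGraph_le hn3 h'⟩ }
  have hset : ({x, y, z, w} : Set (Equiv.Perm (Fin n))) =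
      insert (w * perm12 n hn3 * perm12 n hn3) {x, y, z} := by
    rw [mul_assoc, perm12_mul_self, mul_one, Set.insert_comm w x, Set.insert_comm w y,
      Set.pair_comm w z]
  rw [hset]
  exact (C.hasColouring hn).exists_isIDSTFamily hS hv htilde

end Godan
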